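/- arXiv:2505.22196 — 2 statements merged into one kernel-verified Lean document; each statement's English description precedes it below -/
import Mathlib

section
/- Let f : 𝒳 → ℝ^d be an encoder with ‖f(x)‖ = 1 for all x ∈ 𝒳, assume the identity map belongs to 𝒜, and assume τ_K < 1. Then the supervised risk of the mean classifier satisfies R^sup(f) ≤ (1/(1−τ_K)) · [ R^un(f) − E_{(c,c_1,…,c_K)~π^{K+1}} log(Col(c,{c_k}) + 1) + D_min(f) + 5·D_max(f) ]. -/
open MeasureTheory Real
open scoped BigOperators RealInnerProductSpace

noncomputable section

variable {X : Type*} [MeasurableSpace X] {Ω : Type*} [MeasurableSpace Ω] {d C : ℕ}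

/-- The InfoNCE loss in logistic form:
`L^un(x, x', {x_k}; f) = log(1 + Σ_k exp(−f(x)ᵀ[f(x') − f(x_k)]))`. -/
def infoNCE (f : X → EuclideanSpace ℝ (Fin d)) (K : ℕ) (x x' : X) (xs : Fin K → X) : ℝ :=
  Real.log (1 + ∑ k, Real.exp (-⟪f x, f x' - f (xs k)⟫))

/-- The probability of drawing the class tuple `(c, c_1, …, c_K)` from `π^{K+1}`. -/
def clsWeight (pr : Fin C → ℝ) {K : ℕ} (c : Fin C) (cs : Fin K → Fin C) : ℝ :=
  pr c * ∏ k, pr (cs k)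

/-- The unsupervised contrastive risk `R^un(f)`. -/
def Run (pr : Fin C → ℝ) (ρ : Fin C → Measure X) (PA : Measure Ω) (A : Ω → X → X)
    (f : X → EuclideanSpace ℝ (Fin d)) (K : ℕ) : ℝ :=
  ∑ c, ∑ cs : Fin K → Fin C, clsWeight pr c cs *
    ∫ xb, ∫ xs, ∫ a, ∫ a', ∫ as,
        infoNCE f K (A a xb) (A a' xb) (fun k => A (as k) (xs k))
      ∂(Measure.pi fun _ : Fin K => PA) ∂PA ∂PA
      ∂(Measure.pi fun k => ρ (cs k)) ∂(ρ c)

/-- The mean-classifier weight `μ_c = E_{x̄~ρ_c} f(x̄)`. -/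
def meanRep (ρ : Fin C → Measure X) (f : X → EuclideanSpace ℝ (Fin d)) (c : Fin C) :
    EuclideanSpace ℝ (Fin d) :=
  ∫ xb, f xb ∂(ρ c)

/-- The collision number `Col(c, {c_k}) = Σ_k 1[c_k = c]`. -/
def colNum {K : ℕ} (c : Fin C) (cs : Fin K → Fin C) : ℕ :=
  ∑ k, if cs k = c then 1 else 0

/-- The class-collision probability `τ_K = P(Col ≠ 0)`. -/
def tauK (pr : Fin C → ℝ) (K : ℕ) : ℝ :=
  ∑ c, ∑ cs : Fin K → Fin C, if colNum c cs ≠ 0 then clsWeight pr c cs else 0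

/-- The expected logistic loss of the mean classifier on the task `(c, c_1, …, c_K)`. -/
def supLoss (ρ : Fin C → Measure X) (f : X → EuclideanSpace ℝ (Fin d)) {K : ℕ}
    (c : Fin C) (cs : Fin K → Fin C) : ℝ :=
  ∫ xb, Real.log (1 + ∑ k, Real.exp (-⟪f xb, meanRep ρ f c - meanRep ρ f (cs k)⟫)) ∂(ρ c)

/-- The supervised risk of the mean classifier, conditioned on no class collision. -/
def Rsup (pr : Fin C → ℝ) (ρ : Fin C → Measure X) (f : X → EuclideanSpace ℝ (Fin d))
    (K : ℕ) : ℝ :=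
  (∑ c, ∑ cs : Fin K → Fin C,
    if colNum c cs = 0 then clsWeight pr c cs * supLoss ρ f c cs else 0) / (1 - tauK pr K)

/-- `E_{(c,c_1,…,c_K)~π^{K+1}} log(Col + 1)`. -/
def expLogCol (pr : Fin C → ℝ) (K : ℕ) : ℝ :=
  ∑ c, ∑ cs : Fin K → Fin C, clsWeight pr c cs * Real.log (colNum c cs + 1)

/-- `D_min(f)`: expected minimum distance between augmentations of two i.i.d. same-class
images, `E_c E_{x̄,x̄'~ρ_c} E_a inf_{a'} ‖f(a(x̄)) − f(a'(x̄'))‖`. -/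
def Dmin (pr : Fin C → ℝ) (ρ : Fin C → Measure X) (PA : Measure Ω) (A : Ω → X → X)
    (f : X → EuclideanSpace ℝ (Fin d)) : ℝ :=
  ∑ c, pr c *
    ∫ xb, ∫ xb', ∫ a, (⨅ a' : Ω, ‖f (A a xb) - f (A a' xb')‖) ∂PA ∂(ρ c) ∂(ρ c)

/-- `D_max(f)`: expected maximum distance between two augmentations of the same image,
`E_c E_{x̄'~ρ_c} sup_{a,a'} ‖f(a(x̄')) − f(a'(x̄'))‖`. -/
def Dmax (pr : Fin C → ℝ) (ρ : Fin C → Measure X) (A : Ω → X → X)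
    (f : X → EuclideanSpace ℝ (Fin d)) : ℝ :=
  ∑ c, pr c * ∫ xb', (⨆ p : Ω × Ω, ‖f (A p.1 xb') - f (A p.2 xb')‖) ∂(ρ c)

/-- The intermediate supervised risk `R̄^sup(f)`. -/
def Rbarsup (pr : Fin C → ℝ) (ρ : Fin C → Measure X) (f : X → EuclideanSpace ℝ (Fin d))
    (K : ℕ) : ℝ :=
  ∑ c, ∑ cs : Fin K → Fin C, clsWeight pr c cs * supLoss ρ f c cs

/-- The inner risk `r_k(i_1,…,i_k)` for fixed anchor class `c`, anchor image `xb` and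
anchor augmentation `a`: the first `k` negatives are drawn from classes `i_1,…,i_k` and
the remaining `K − k` negatives from class `c`. -/
def innerRisk (ρ : Fin C → Measure X) (PA : Measure Ω) (A : Ω → X → X)
    (f : X → EuclideanSpace ℝ (Fin d)) (K : ℕ) (c : Fin C) (xb : X) (a : Ω)
    (k : ℕ) (i : Fin k → Fin C) : ℝ :=
  ∫ xs, ∫ a', ∫ as, infoNCE f K (A a xb) (A a' xb) (fun j => A (as j) (xs j))
    ∂(Measure.pi fun _ : Fin K => PA) ∂PA
    ∂(Measure.pi fun j : Fin K => ρ (if h : (j : ℕ) < k then i ⟨j, h⟩ else c))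

/-- The weight `p_k(i_1,…,i_k) = binom(K,k)·π_{i_1}⋯π_{i_k}·π_c^{K−k}`. -/
def pWeight (pr : Fin C → ℝ) (K : ℕ) (c : Fin C) (k : ℕ) (i : Fin k → Fin C) : ℝ :=
  (Nat.choose K k : ℝ) * (∏ m, pr (i m)) * pr c ^ (K - k)

/-- `r_k^sup(i_1,…,i_k) = log(1 + (K−k) + Σ_{m=1}^k exp(−uᵀ(μ_c − μ_{i_m})))`, where
`u` is the representation of the anchor. -/
def rkSup (ρ : Fin C → Measure X) (f : X → EuclideanSpace ℝ (Fin d)) (K : ℕ)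
    (c : Fin C) (u : EuclideanSpace ℝ (Fin d)) (k : ℕ) (i : Fin k → Fin C) : ℝ :=
  Real.log (1 + ((K - k : ℕ) : ℝ) +
    ∑ m, Real.exp (-⟪u, meanRep ρ f c - meanRep ρ f (i m)⟫))

/-- Tangent-plane inequality for the log-sum-exp function. -/
lemma lse_tangent {K : ℕ} (u v : Fin K → ℝ) :
    Real.log (1 + ∑ k, Real.exp (u k)) +
      ∑ k, (Real.exp (u k) / (1 + ∑ l, Real.exp (u l))) * (v k - u k)
      ≤ Real.log (1 + ∑ k, Real.exp (v k)) := by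
  set S := 1 + ∑ l, Real.exp (u l) with hS
  have hSpos : 0 < S := by positivity
  have hTpos : 0 < 1 + ∑ k, Real.exp (v k) := by positivity
  set δ := ∑ k, (Real.exp (u k) / S) * (v k - u k) with hδ
  have hδS : δ * S = ∑ k, Real.exp (u k) * (v k - u k) := by
    rw [hδ, Finset.sum_mul]
    refine Finset.sum_congr rfl fun k _ => ?_
    field_simp
  have key : Real.exp δ * S ≤ 1 + ∑ k, Real.exp (v k) := by
    have h0 : Real.exp δ * (1 - δ) ≤ 1 := by
      have := Real.add_one_le_exp (-δ)
      calc Real.exp δ * (1 - δ) ≤ Real.exp δ * Real.exp (-δ) := by gcongr; linarith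
        _ = 1 := by rw [← Real.exp_add]; simp
    have hk : ∀ k, Real.exp δ * (Real.exp (u k) * (1 + (v k - u k) - δ)) ≤ Real.exp (v k) := by
      intro k
      have := Real.add_one_le_exp (v k - u k - δ)
      calc Real.exp δ * (Real.exp (u k) * (1 + (v k - u k) - δ))
          ≤ Real.exp δ * (Real.exp (u k) * Real.exp (v k - u k - δ)) := by gcongr; linarith
        _ = Real.exp (v k) := by rw [← Real.exp_add, ← Real.exp_add]; ring_nf
    have hs := Finset.sum_le_sum fun k (_ : k ∈ Finset.univ) => hk k
    rw [← Finset.mul_sum] at hs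
    have e : ∑ k, Real.exp (u k) * (1 + (v k - u k) - δ) = (S - 1) * (1 - δ) + δ * S := by
      rw [hδS, hS, add_sub_cancel_left, Finset.sum_mul, ← Finset.sum_add_distrib]
      exact Finset.sum_congr rfl fun k _ => by ring
    rw [e] at hs
    nlinarith
  rw [← Real.log_exp δ, ← Real.log_mul hSpos.ne' (Real.exp_pos _).ne', mul_comm]
  exact Real.log_le_log (by positivity) key

lemma scalar_bound (r q : ℝ) (hr : 0 < r) (hq : q ≤ r - r ^ 2) :
    Real.cosh r + q / r * Real.sinh r ≤ 2 := by
  have hs : 0 ≤ Real.sinh r := Real.sinh_nonneg_iff.2 hr.le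
  have h1 : q / r ≤ 1 - r := by rw [div_le_iff₀ hr]; nlinarith
  have h2 : q / r * Real.sinh r ≤ (1 - r) * Real.sinh r := by gcongr
  have h3 : (2 - r) * Real.exp r ≤ Real.exp 1 := by
    have := Real.add_one_le_exp (1 - r)
    calc (2 - r) * Real.exp r ≤ Real.exp (1 - r) * Real.exp r := by gcongr; linarith
      _ = Real.exp 1 := by rw [← Real.exp_add]; ring_nf
  have h4 : r * Real.exp (-r) ≤ 1 := by
    have := Real.add_one_le_exp r
    calc r * Real.exp (-r) ≤ Real.exp r * Real.exp (-r) := by gcongr; linarith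
      _ = 1 := by rw [← Real.exp_add]; simp
  have h5 := Real.exp_one_lt_d9
  rw [Real.cosh_eq, Real.sinh_eq] at *
  nlinarith

lemma exp_bound (r y : ℝ) (hr : 0 < r) (hy : |y| ≤ r) :
    Real.exp y ≤ Real.cosh r + y / r * Real.sinh r := by
  have := Real.exp_mul_le_cosh_add_mul_sinh (t := y / r)
    (by rw [abs_div, abs_of_pos hr]; exact (div_le_one hr).2 hy) r
  rwa [div_mul_cancel₀ _ hr.ne'] at this

/-- Softmax weight of the class tuple `t` at index `j` for representation `u`. -/
def smax {N : ℕ} (m : Fin N → EuclideanSpace ℝ (Fin d)) (u : EuclideanSpace ℝ (Fin d))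
    (j : Fin N) : ℝ :=
  Real.exp (inner ℝ u (m j)) / ∑ l, Real.exp (inner ℝ u (m l))

lemma smax_nonneg {N : ℕ} (m : Fin N → EuclideanSpace ℝ (Fin d)) (u) (j : Fin N) :
    0 ≤ smax m u j := by unfold smax; positivity

lemma smax_sum {N : ℕ} (m : Fin (N+1) → EuclideanSpace ℝ (Fin d)) (u) :
    ∑ j, smax m u j = 1 := by
  unfold smax
  rw [← Finset.sum_div, div_self]
  positivity

lemma smax_le_one {N : ℕ} (m : Fin (N+1) → EuclideanSpace ℝ (Fin d)) (u) (j) :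
    smax m u j ≤ 1 := by
  rw [← smax_sum m u]
  exact Finset.single_le_sum (fun j _ => smax_nonneg m u j) (Finset.mem_univ j)

lemma smax_meas {N : ℕ} (m : Fin N → EuclideanSpace ℝ (Fin d)) (j) :
    Measurable (fun u => smax m u j) := by
  unfold smax
  fun_prop

lemma smax_perm {N : ℕ} (m : Fin N → EuclideanSpace ℝ (Fin d)) (u) (j)
    (σ : Equiv.Perm (Fin N)) : smax (m ∘ σ) u j = smax m u (σ j) := by
  unfold smax
  congr 1
  exact Equiv.sum_comp σ (fun l => Real.exp (inner ℝ u (m l)))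

lemma smax_le {N : ℕ} (m : Fin (N+1) → EuclideanSpace ℝ (Fin d)) (u) (j) :
    smax m u j ≤
      Real.exp (inner ℝ u (m j - ((N:ℝ)+1)⁻¹ • ∑ l, m l)) / (N+1) := by
  unfold smax
  have hN : (0:ℝ) < (N:ℝ)+1 := by positivity
  set s := inner ℝ u (((N:ℝ)+1)⁻¹ • ∑ l, m l) with hs
  have hs' : s * (N+1) = ∑ l, inner ℝ u (m l) := by
    rw [hs, inner_smul_right, inner_sum]; field_simp
  have h : ((N:ℝ)+1) * Real.exp s ≤ ∑ l, Real.exp (inner ℝ u (m l)) := by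
    have : ∀ l, Real.exp s * (1 + (inner ℝ u (m l) - s)) ≤ Real.exp (inner ℝ u (m l)) := by
      intro l
      have := Real.add_one_le_exp (inner ℝ u (m l) - s)
      calc _ ≤ Real.exp s * Real.exp (inner ℝ u (m l) - s) := by gcongr; linarith
        _ = _ := by rw [← Real.exp_add]; ring_nf
    refine le_trans (le_of_eq ?_) (Finset.sum_le_sum fun l _ => this l)
    rw [← Finset.mul_sum, Finset.sum_add_distrib, Finset.sum_sub_distrib, ← hs']
    simp; ring
  rw [inner_sub_right, ← hs, Real.exp_sub, div_div, mul_comm]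
  rw [mul_comm] at h
  gcongr
  rwa [mul_comm]

lemma norm_meanRep_le (ρ : Fin C → Measure X) [∀ c, IsProbabilityMeasure (ρ c)]
    (f : X → EuclideanSpace ℝ (Fin d)) (hf : ∀ x, ‖f x‖ = 1) (c) : ‖meanRep ρ f c‖ ≤ 1 := by
  unfold meanRep
  have := norm_integral_le_of_norm_le_const (μ := ρ c) (f := f) (C := 1)
    (Filter.Eventually.of_forall fun x => (hf x).le)
  simpa using this

lemma integrable_enc (ν : Measure X) [IsProbabilityMeasure ν]
    (f : X → EuclideanSpace ℝ (Fin d)) (hfm : Measurable f) (hf : ∀ x, ‖f x‖ = 1) :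
    Integrable f ν :=
  Integrable.of_bound hfm.aestronglyMeasurable 1 (Filter.Eventually.of_forall fun x => (hf x).le)

lemma integrable_bdd {Y : Type*} [MeasurableSpace Y] (ν : Measure Y) [IsProbabilityMeasure ν]
    (g : Y → ℝ) (hg : Measurable g) (B : ℝ) (hB : ∀ x, |g x| ≤ B) : Integrable g ν :=
  Integrable.of_bound hg.aestronglyMeasurable B (Filter.Eventually.of_forall hB)

/-- Column sums of the averaged softmax matrix are at most two. -/
lemma col_bound {N : ℕ} (ρ : Fin C → Measure X) [∀ c, IsProbabilityMeasure (ρ c)]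
    (f : X → EuclideanSpace ℝ (Fin d)) (hfm : Measurable f) (hf : ∀ x, ‖f x‖ = 1)
    (t : Fin (N+1) → Fin C) (j : Fin (N+1)) :
    ∑ i, ∫ x, smax (fun l => meanRep ρ f (t l)) (f x) j ∂(ρ (t i)) ≤ 2 := by
  have hN : (0:ℝ) < (N:ℝ)+1 := by positivity
  set m : Fin (N+1) → EuclideanSpace ℝ (Fin d) := fun l => meanRep ρ f (t l) with hm
  set M := ((N:ℝ)+1)⁻¹ • ∑ l, m l with hM
  set w := m j - M with hw
  have hint : ∀ i, Integrable (fun x => smax m (f x) j) (ρ (t i)) := fun i =>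
    integrable_bdd _ _ ((smax_meas m j).comp hfm) 1 fun x => by
      rw [abs_of_nonneg (smax_nonneg _ _ _)]; exact smax_le_one _ _ _
  have hyr : ∀ x, |inner ℝ (f x) w| ≤ ‖w‖ := fun x => by
    simpa [hf x] using abs_real_inner_le_norm (f x) w
  rcases eq_or_ne w 0 with h0 | h0
  · have : ∀ i, ∫ x, smax m (f x) j ∂(ρ (t i)) ≤ ((N:ℝ)+1)⁻¹ := by
      intro i
      have h := integral_mono (hint i) (integrable_const (((N:ℝ)+1)⁻¹)) fun x => by
        have := smax_le m (f x) j
        rw [← hM, ← hw, h0] at this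
        simpa using this
      simpa using h
    refine (Finset.sum_le_sum fun i _ => this i).trans ?_
    simp
    rw [mul_inv_cancel₀ hN.ne']; norm_num
  · have hr : 0 < ‖w‖ := norm_pos_iff.2 h0
    set r := ‖w‖ with hrdef
    have hie : ∀ c, ∫ x, inner ℝ (f x) w ∂(ρ c) = inner ℝ (meanRep ρ f c) w := by
      intro c
      simp_rw [real_inner_comm w]
      exact integral_inner (integrable_enc _ f hfm hf) w
    have hii : ∀ c, Integrable (fun x => inner ℝ (f x) w) (ρ c) := fun c =>
      integrable_bdd _ _ (by fun_prop) r hyr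
    have : ∀ i, ∫ x, smax m (f x) j ∂(ρ (t i)) ≤
        (Real.cosh r + inner ℝ (m i) w * (Real.sinh r / r)) / (N+1) := by
      intro i
      have h := integral_mono (hint i)
        (((integrable_const (Real.cosh r)).add ((hii (t i)).mul_const (Real.sinh r / r))).div_const
          ((N:ℝ)+1)) fun x => by
        have := smax_le m (f x) j
        rw [← hM, ← hw] at this
        refine this.trans ?_
        have h2 := exp_bound r _ hr (hyr x)
        simp only [Pi.add_apply]
        rw [div_mul_eq_mul_div, mul_div_assoc] at h2
        gcongr
      refine h.trans (le_of_eq ?_)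
      rw [integral_div]
      simp only [Pi.add_apply]
      rw [integral_add (integrable_const _) ((hii (t i)).mul_const _), integral_mul_const, hie]
      simp [hm]
    refine (Finset.sum_le_sum fun i _ => this i).trans ?_
    have e : ∑ i, inner ℝ (m i) w = ((N:ℝ)+1) * inner ℝ M w := by
      rw [hM, inner_smul_left, sum_inner]; simp; field_simp
    rw [← Finset.sum_div, Finset.sum_add_distrib, ← Finset.sum_mul, e]
    have hq : inner ℝ M w ≤ r - r ^ 2 := by
      have h1 : inner ℝ (m j) w ≤ r := by
        refine (real_inner_le_norm _ _).trans ?_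
        have := norm_meanRep_le ρ f hf (t j)
        calc _ ≤ 1 * ‖w‖ := by gcongr
          _ = r := by simp [hrdef]
      have h2 : inner ℝ (m j) w = inner ℝ M w + r ^ 2 := by
        rw [hrdef, ← real_inner_self_eq_norm_sq, ← inner_add_left, hw]; simp
      linarith
    have := scalar_bound r _ hr hq
    refine le_trans (le_of_eq ?_) this
    simp
    field_simp

lemma sum_cons {K : ℕ} (F : (Fin (K+1) → Fin C) → ℝ) :
    ∑ c, ∑ cs : Fin K → Fin C, F (Fin.cons c cs) = ∑ t, F t := by
  rw [← Fintype.sum_prod_type' (f := fun (c : Fin C) (cs : Fin K → Fin C) => F (Fin.cons c cs))]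
  exact Equiv.sum_comp (Fin.consEquiv (fun _ : Fin (K+1) => Fin C)) F

lemma clsWeight_cons {K : ℕ} (pr : Fin C → ℝ) (c : Fin C) (cs : Fin K → Fin C) :
    clsWeight pr c cs = ∏ j, pr ((Fin.cons c cs : Fin (K+1) → Fin C) j) := by
  simp [clsWeight, Fin.prod_univ_succ]

lemma sum_perm {N : ℕ} (σ : Equiv.Perm (Fin N)) (F : (Fin N → Fin C) → ℝ) :
    ∑ t, F (t ∘ σ) = ∑ t, F t :=
  Equiv.sum_comp (Equiv.arrowCongr σ.symm (Equiv.refl (Fin C))) F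

lemma sum_weights {K : ℕ} (pr : Fin C → ℝ) (hpr1 : ∑ c, pr c = 1) :
    ∑ cs : Fin K → Fin C, ∏ k, pr (cs k) = 1 := by
  have := Finset.prod_univ_sum (fun _ : Fin K => (Finset.univ : Finset (Fin C))) (fun _ c => pr c)
  simp only [hpr1, Finset.prod_const_one, Fintype.piFinset_univ] at this
  exact this.symm

lemma sum_first {K : ℕ} (pr : Fin C → ℝ) (hpr1 : ∑ c, pr c = 1) (D : Fin C → ℝ) :
    ∑ c, ∑ cs : Fin K → Fin C, clsWeight pr c cs * D c = ∑ c, pr c * D c := by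
  refine Finset.sum_congr rfl fun c _ => ?_
  simp only [clsWeight]
  rw [← Finset.sum_mul, ← Finset.mul_sum, sum_weights pr hpr1, mul_one]

lemma sum_any {K : ℕ} (pr : Fin C → ℝ) (hpr1 : ∑ c, pr c = 1) (D : Fin C → ℝ)
    (j : Fin (K+1)) :
    ∑ t : Fin (K+1) → Fin C, (∏ i, pr (t i)) * D (t j) = ∑ c, pr c * D c := by
  rw [← sum_first (K := K) pr hpr1 D, ← sum_perm (Equiv.swap 0 j)]
  rw [← sum_cons (fun t => (∏ i, pr ((t ∘ Equiv.swap 0 j) i)) * D ((t ∘ Equiv.swap 0 j) j))]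
  refine Finset.sum_congr rfl fun c _ => Finset.sum_congr rfl fun cs _ => ?_
  rw [clsWeight_cons]
  congr 1
  · exact Equiv.prod_comp (Equiv.swap 0 j)
      (fun i => pr ((Fin.cons c cs : Fin (K+1) → Fin C) i))
  · simp

lemma exch_bound (K : ℕ) (pr : Fin C → ℝ) (hpr : ∀ c, 0 ≤ pr c) (hpr1 : ∑ c, pr c = 1)
    (ρ : Fin C → Measure X) [∀ c, IsProbabilityMeasure (ρ c)]
    (f : X → EuclideanSpace ℝ (Fin d)) (hfm : Measurable f) (hf : ∀ x, ‖f x‖ = 1)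
    (D : Fin C → ℝ) (hD : ∀ c, 0 ≤ D c) :
    ∑ c, ∑ cs : Fin K → Fin C, clsWeight pr c cs *
      ∑ k, (∫ x, smax (fun l => meanRep ρ f ((Fin.cons c cs : Fin (K+1) → Fin C) l)) (f x) k.succ
        ∂(ρ c)) * D (cs k) ≤ 2 * ∑ c, pr c * D c := by
  have hN : (0:ℝ) < (K:ℝ)+1 := by positivity
  let G : Fin (K+1) → (Fin (K+1) → Fin C) → ℝ := fun i t => (∏ i, pr (t i)) *
      ∑ j, (∫ x, smax (fun l => meanRep ρ f (t l)) (f x) j ∂(ρ (t i))) * D (t j)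
  have hw : ∀ t : Fin (K+1) → Fin C, 0 ≤ ∏ i, pr (t i) := fun t =>
    Finset.prod_nonneg fun i _ => hpr _
  have h1 : ∑ c, ∑ cs : Fin K → Fin C, clsWeight pr c cs *
      ∑ k, (∫ x, smax (fun l => meanRep ρ f ((Fin.cons c cs : Fin (K+1) → Fin C) l)) (f x) k.succ
        ∂(ρ c)) * D (cs k) ≤ ∑ t, G 0 t := by
    rw [← sum_cons]
    refine Finset.sum_le_sum fun c _ => Finset.sum_le_sum fun cs _ => ?_
    rw [clsWeight_cons]
    refine mul_le_mul_of_nonneg_left ?_ (hw _)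
    rw [Fin.sum_univ_succ]
    simp only [Fin.cons_zero, Fin.cons_succ]
    have : 0 ≤ (∫ x, smax (fun l => meanRep ρ f ((Fin.cons c cs : Fin (K+1) → Fin C) l)) (f x) 0
        ∂(ρ c)) * D c := mul_nonneg (integral_nonneg fun x => smax_nonneg _ _ _) (hD c)
    linarith
  have h2 : ∀ i, ∑ t, G i t = ∑ t, G 0 t := by
    intro i
    rw [← sum_perm (Equiv.swap 0 i) (G i)]
    refine Finset.sum_congr rfl fun t _ => ?_
    simp only [G]
    congr 1
    · exact Equiv.prod_comp (Equiv.swap 0 i) (fun i => pr (t i))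
    · rw [← Equiv.sum_comp (Equiv.swap 0 i)
        (fun j => (∫ x, smax (fun l => meanRep ρ f (t l)) (f x) j ∂(ρ (t 0))) * D (t j))]
      refine Finset.sum_congr rfl fun j _ => ?_
      simp only [Function.comp, Equiv.swap_apply_right]
      congr 2
      funext x
      exact smax_perm (fun l => meanRep ρ f (t l)) (f x) j (Equiv.swap 0 i)
  have h3 : ∑ i, ∑ t, G i t = (K+1) * ∑ t, G 0 t := by
    simp [h2]
  have h4 : ∑ i, ∑ t, G i t ≤ (K+1) * (2 * ∑ c, pr c * D c) := by
    rw [Finset.sum_comm]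
    calc ∑ t, ∑ i, G i t ≤ ∑ t : Fin (K+1) → Fin C, (∏ i, pr (t i)) * ∑ j, 2 * D (t j) := by
          refine Finset.sum_le_sum fun t _ => ?_
          simp only [G]
          rw [← Finset.mul_sum, Finset.sum_comm]
          refine mul_le_mul_of_nonneg_left (Finset.sum_le_sum fun j _ => ?_) (hw t)
          rw [← Finset.sum_mul]
          exact mul_le_mul_of_nonneg_right (col_bound ρ f hfm hf t j) (hD _)
      _ = ∑ j : Fin (K+1), 2 * ∑ t : Fin (K+1) → Fin C, (∏ i, pr (t i)) * D (t j) := by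
          simp_rw [Finset.mul_sum]
          rw [Finset.sum_comm]
          refine Finset.sum_congr rfl fun j _ => Finset.sum_congr rfl fun t _ => by ring
      _ = _ := by simp [sum_any pr hpr1 D]
  rw [h3] at h4
  exact h1.trans (le_of_mul_le_mul_left h4 hN)

lemma int_step {α β : Type*} [MeasurableSpace α] [MeasurableSpace β] (ν : Measure β)
    [IsProbabilityMeasure ν] (h : α → β → ℝ) (hm : StronglyMeasurable (Function.uncurry h))
    (B : ℝ) (hB : ∀ x y, |h x y| ≤ B) :
    StronglyMeasurable (fun x => ∫ y, h x y ∂ν) ∧ ∀ x, |∫ y, h x y ∂ν| ≤ B := by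
  refine ⟨hm.integral_prod_right, fun x => ?_⟩
  have := norm_integral_le_of_norm_le_const (μ := ν) (f := h x) (C := B)
    (Filter.Eventually.of_forall fun y => hB x y)
  simpa using this

lemma infoNCE_abs (f : X → EuclideanSpace ℝ (Fin d)) (hf : ∀ x, ‖f x‖ = 1) (K : ℕ)
    (x x' : X) (xs : Fin K → X) :
    |infoNCE f K x x' xs| ≤ Real.log (1 + K * Real.exp 2) := by
  unfold infoNCE
  have h0 : (0:ℝ) ≤ ∑ k, Real.exp (-⟪f x, f x' - f (xs k)⟫) := by positivity
  rw [abs_of_nonneg (Real.log_nonneg (by linarith))]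
  refine Real.log_le_log (by linarith) ?_
  gcongr
  have : ∀ k, Real.exp (-⟪f x, f x' - f (xs k)⟫) ≤ Real.exp 2 := by
    intro k
    rw [Real.exp_le_exp]
    refine (neg_le_abs _).trans ((abs_real_inner_le_norm _ _).trans ?_)
    rw [hf x, one_mul]
    refine (norm_sub_le _ _).trans ?_
    rw [hf, hf]; norm_num
  refine (Finset.sum_le_sum fun k _ => this k).trans ?_
  simp

/-- Pointwise lower bound on the InfoNCE loss. -/
lemma infoNCE_lower {K : ℕ} (ρ : Fin C → Measure X) [∀ c, IsProbabilityMeasure (ρ c)]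
    (A : Ω → X → X) (f : X → EuclideanSpace ℝ (Fin d)) (hf : ∀ x, ‖f x‖ = 1)
    (M : X → ℝ) (hM : ∀ a x, ‖f (A a x) - f x‖ ≤ M x)
    (c : Fin C) (cs : Fin K → Fin C) (xb : X) (xs : Fin K → X) (a a' : Ω) (as : Fin K → Ω) :
    Real.log (1 + ∑ k, Real.exp (-⟪f xb, meanRep ρ f c - meanRep ρ f (cs k)⟫))
      - (1 - inner ℝ (f xb) (meanRep ρ f c)) - M xb
      + ∑ k, smax (fun l => meanRep ρ f ((Fin.cons c cs : Fin (K+1) → Fin C) l)) (f xb) k.succ *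
        (inner ℝ (f xb) (f (xs k)) - inner ℝ (f xb) (meanRep ρ f (cs k)) - M (xs k))
      ≤ infoNCE f K (A a xb) (A a' xb) (fun k => A (as k) (xs k)) := by
  have hfle : ∀ x y, inner ℝ (f x) (f y) ≤ 1 := fun x y => by
    simpa [hf] using real_inner_le_norm (f x) (f y)
  refine le_trans ?_ (lse_tangent (fun k => -⟪f xb, meanRep ρ f c - meanRep ρ f (cs k)⟫) _)
  have hμ : inner ℝ (f xb) (meanRep ρ f c) ≤ 1 := by
    have := real_inner_le_norm (f xb) (meanRep ρ f c)
    rw [hf, one_mul] at this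
    exact this.trans (norm_meanRep_le ρ f hf c)
  have hM0 : 0 ≤ M xb := (norm_nonneg _).trans (hM a xb)
  set p : Fin (K+1) → ℝ :=
    smax (fun l => meanRep ρ f ((Fin.cons c cs : Fin (K+1) → Fin C) l)) (f xb) with hp
  have hp0 : ∀ j, 0 ≤ p j := fun j => smax_nonneg _ _ _
  have hp1 : ∑ k : Fin K, p k.succ ≤ 1 := by
    have := smax_sum (fun l => meanRep ρ f ((Fin.cons c cs : Fin (K+1) → Fin C) l)) (f xb)
    rw [← hp, Fin.sum_univ_succ] at this
    linarith [hp0 0]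
  have hpk : ∀ k : Fin K, Real.exp (-⟪f xb, meanRep ρ f c - meanRep ρ f (cs k)⟫) /
      (1 + ∑ l, Real.exp (-⟪f xb, meanRep ρ f c - meanRep ρ f (cs l)⟫)) = p k.succ := by
    intro k
    simp only [hp, smax, Fin.sum_univ_succ, Fin.cons_zero, Fin.cons_succ]
    have e : ∀ l, Real.exp (-⟪f xb, meanRep ρ f c - meanRep ρ f (cs l)⟫) =
      Real.exp (-⟪f xb, meanRep ρ f c⟫) * Real.exp ⟪f xb, meanRep ρ f (cs l)⟫ := by
      intro l; rw [← Real.exp_add, inner_sub_right]; ring_nf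
    have e1 : (1:ℝ) = Real.exp (-⟪f xb, meanRep ρ f c⟫) * Real.exp ⟪f xb, meanRep ρ f c⟫ := by
      rw [← Real.exp_add]; simp
    simp_rw [e]
    rw [← Finset.mul_sum]
    nth_rewrite 1 [e1]
    rw [← mul_add, mul_div_mul_left _ _ (Real.exp_pos _).ne']
  simp_rw [hpk]
  set q := (1 - inner ℝ (f xb) (meanRep ρ f c)) + M xb with hq
  have hq0 : 0 ≤ q := by linarith
  have hs : ∑ k : Fin K, p k.succ * (-q) ≥ -q := by
    rw [← Finset.sum_mul]; nlinarith
  have hk : ∀ k : Fin K, p k.succ * (-q) + p k.succ *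
      (inner ℝ (f xb) (f (xs k)) - inner ℝ (f xb) (meanRep ρ f (cs k)) - M (xs k)) ≤
      p k.succ * (-⟪f (A a xb), f (A a' xb) - f (A (as k) (xs k))⟫ -
        -⟪f xb, meanRep ρ f c - meanRep ρ f (cs k)⟫) := by
    intro k
    rw [← mul_add]
    refine mul_le_mul_of_nonneg_left ?_ (hp0 _)
    rw [inner_sub_right, inner_sub_right]
    have h1 := hfle (A a xb) (A a' xb)
    have h2 : inner ℝ (f xb - f (A a xb)) (f (xs k)) ≤ M xb := by
      refine (real_inner_le_norm _ _).trans ?_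
      rw [hf, mul_one, norm_sub_rev]; exact hM a xb
    have h3 : inner ℝ (f (A a xb)) (f (xs k) - f (A (as k) (xs k))) ≤ M (xs k) := by
      refine (real_inner_le_norm _ _).trans ?_
      rw [hf, one_mul, norm_sub_rev]; exact hM _ _
    rw [inner_sub_left] at h2
    rw [inner_sub_right] at h3
    linarith
  have hsum := Finset.sum_le_sum fun k (_ : k ∈ Finset.univ) => hk k
  rw [Finset.sum_add_distrib] at hsum
  linarith

lemma integral_eval {K : ℕ} (ν : Fin K → Measure X) [∀ k, IsProbabilityMeasure (ν k)]
    (k : Fin K) (g : X → ℝ) (hg : Integrable g (ν k)) :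
    Integrable (fun xs : Fin K → X => g (xs k)) (Measure.pi ν) ∧
      ∫ xs, g (xs k) ∂(Measure.pi ν) = ∫ x, g x ∂(ν k) := by
  have hmp : MeasurePreserving (Function.eval k) (Measure.pi ν) (ν k) := measurePreserving_eval ν k
  refine ⟨hmp.integrable_comp_of_integrable hg, ?_⟩
  have := integral_map (μ := Measure.pi ν) (φ := Function.eval k) (f := g)
    hmp.measurable.aemeasurable (by rw [hmp.map_eq]; exact hg.aestronglyMeasurable)
  rw [hmp.map_eq] at this
  exact this.symm

lemma int_step' {α β : Type*} [MeasurableSpace α] [MeasurableSpace β] (ν : Measure β)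
    [IsProbabilityMeasure ν] (h : α × β → ℝ) (hm : StronglyMeasurable h)
    (B : ℝ) (hB : ∀ q, |h q| ≤ B) :
    StronglyMeasurable (fun x => ∫ y, h (x, y) ∂ν) ∧ (∀ x, |∫ y, h (x, y) ∂ν| ≤ B) ∧
      ∀ x, Integrable (fun y => h (x, y)) ν := by
  have := int_step ν (fun x y => h (x, y)) hm B (fun x y => hB (x, y))
  exact ⟨this.1, this.2, fun x => integrable_bdd _ _
    (hm.measurable.comp (measurable_prodMk_left (x := x))) B fun y => hB (x, y)⟩

lemma const_le_integral {β : Type*} [MeasurableSpace β] (ν : Measure β)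
    [IsProbabilityMeasure ν] (g : β → ℝ) (hg : Integrable g ν) (L : ℝ) (h : ∀ y, L ≤ g y) :
    L ≤ ∫ y, g y ∂ν := by
  simpa using integral_mono (integrable_const L) hg h

lemma iter_bound {Y Z : Type*} [MeasurableSpace Y] [MeasurableSpace Z]
    (ν : Measure X) [IsProbabilityMeasure ν] (νY : Measure Y) [IsProbabilityMeasure νY]
    (PA : Measure Ω) [IsProbabilityMeasure PA] (νZ : Measure Z) [IsProbabilityMeasure νZ]
    (F : X → Y → Ω → Ω → Z → ℝ)
    (hF : Measurable fun q : (((X × Y) × Ω) × Ω) × Z => F q.1.1.1.1 q.1.1.1.2 q.1.1.2 q.1.2 q.2)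
    (B : ℝ) (hB : ∀ x y a a' z, |F x y a a' z| ≤ B) :
    Integrable (fun x => ∫ y, ∫ a, ∫ a', ∫ z, F x y a a' z ∂νZ ∂PA ∂PA ∂νY) ν ∧
    ∀ x (L : Y → ℝ), Integrable L νY → (∀ y a a' z, L y ≤ F x y a a' z) →
      ∫ y, L y ∂νY ≤ ∫ y, ∫ a, ∫ a', ∫ z, F x y a a' z ∂νZ ∂PA ∂PA ∂νY := by
  obtain ⟨m1, b1, i1⟩ := int_step' νZ _ hF.stronglyMeasurable B (fun q => hB _ _ _ _ _)
  obtain ⟨m2, b2, i2⟩ := int_step' PA _ m1 B b1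
  obtain ⟨m3, b3, i3⟩ := int_step' PA _ m2 B b2
  obtain ⟨m4, b4, i4⟩ := int_step' νY _ m3 B b3
  refine ⟨integrable_bdd ν _ m4.measurable B b4, fun x L hL hle => ?_⟩
  refine integral_mono hL (i4 x) fun y => ?_
  refine const_le_integral PA _ (i3 (x, y)) _ fun a => ?_
  refine const_le_integral PA _ (i2 ((x, y), a)) _ fun a' => ?_
  exact const_le_integral νZ _ (i1 (((x, y), a), a')) _ fun z => hle y a a' z

lemma integrable_add_eq {β : Type*} [MeasurableSpace β] {ν : Measure β} {g h : β → ℝ}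
    (hg : Integrable g ν) (hh : Integrable h ν) :
    Integrable (fun x => g x + h x) ν ∧
      ∫ x, (g x + h x) ∂ν = ∫ x, g x ∂ν + ∫ x, h x ∂ν :=
  ⟨hg.add hh, integral_add hg hh⟩

lemma integrable_sub_eq {β : Type*} [MeasurableSpace β] {ν : Measure β} {g h : β → ℝ}
    (hg : Integrable g ν) (hh : Integrable h ν) :
    Integrable (fun x => g x - h x) ν ∧
      ∫ x, (g x - h x) ∂ν = ∫ x, g x ∂ν - ∫ x, h x ∂ν :=
  ⟨hg.sub hh, integral_sub hg hh⟩

set_option maxHeartbeats 2000000 in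
/-- The bound for a fixed class tuple. -/
lemma tuple_bound (K : ℕ) (ρ : Fin C → Measure X) [∀ c, IsProbabilityMeasure (ρ c)]
    (PA : Measure Ω) [IsProbabilityMeasure PA]
    (A : Ω → X → X) (hA : Measurable fun p : Ω × X => A p.1 p.2)
    (f : X → EuclideanSpace ℝ (Fin d)) (hfm : Measurable f) (hf : ∀ x, ‖f x‖ = 1)
    (M : X → ℝ) (hM : ∀ a x, ‖f (A a x) - f x‖ ≤ M x) (hMi : ∀ c, Integrable M (ρ c))
    (E : Fin C → X → ℝ) (hE : ∀ c, Integrable (E c) (ρ c))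
    (hE' : ∀ c x, 1 - inner ℝ (f x) (meanRep ρ f c) ≤ E c x + M x + ∫ x', M x' ∂(ρ c))
    (c : Fin C) (cs : Fin K → Fin C) :
    supLoss ρ f c cs ≤
      (∫ xb, ∫ xs, ∫ a, ∫ a', ∫ as,
        infoNCE f K (A a xb) (A a' xb) (fun k => A (as k) (xs k))
      ∂(Measure.pi fun _ : Fin K => PA) ∂PA ∂PA
      ∂(Measure.pi fun k => ρ (cs k)) ∂(ρ c)) + ∫ x, E c x ∂(ρ c) + 3 * ∫ x, M x ∂(ρ c)
      + ∑ k, (∫ x, smax (fun l => meanRep ρ f ((Fin.cons c cs : Fin (K+1) → Fin C) l)) (f x) k.succ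
        ∂(ρ c)) * ∫ x, M x ∂(ρ (cs k)) := by
  set B := Real.log (1 + K * Real.exp 2) with hB
  -- joint measurability
  have m0 : Measurable fun q : (((X × (Fin K → X)) × Ω) × Ω) × (Fin K → Ω) =>
      infoNCE f K (A q.1.1.2 q.1.1.1.1) (A q.1.2 q.1.1.1.1)
        (fun k => A (q.2 k) (q.1.1.1.2 k)) := by
    unfold infoNCE
    have f1 : Measurable fun p : (((X × (Fin K → X)) × Ω) × Ω) × (Fin K → Ω) =>
        f (A p.1.1.2 p.1.1.1.1) := hfm.comp (hA.comp (by fun_prop :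
          Measurable fun p : (((X × (Fin K → X)) × Ω) × Ω) × (Fin K → Ω) =>
            (p.1.1.2, p.1.1.1.1)))
    have f2 : Measurable fun p : (((X × (Fin K → X)) × Ω) × Ω) × (Fin K → Ω) =>
        f (A p.1.2 p.1.1.1.1) := hfm.comp (hA.comp (by fun_prop :
          Measurable fun p : (((X × (Fin K → X)) × Ω) × Ω) × (Fin K → Ω) =>
            (p.1.2, p.1.1.1.1)))
    have f3 : ∀ k, Measurable fun p : (((X × (Fin K → X)) × Ω) × Ω) × (Fin K → Ω) =>
        f (A (p.2 k) (p.1.1.1.2 k)) := fun k => hfm.comp (hA.comp (by fun_prop :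
          Measurable fun p : (((X × (Fin K → X)) × Ω) × Ω) × (Fin K → Ω) =>
            (p.2 k, p.1.1.1.2 k)))
    fun_prop
  obtain ⟨hF, hFlow⟩ := iter_bound (ρ c) (Measure.pi fun k => ρ (cs k)) PA
    (Measure.pi fun _ : Fin K => PA)
    (fun xb xs a a' as => infoNCE f K (A a xb) (A a' xb) (fun k => A (as k) (xs k))) m0 B
    (fun _ _ _ _ _ => infoNCE_abs f hf K _ _ _)
  -- the lower bound function
  set p : X → Fin (K+1) → ℝ := fun x =>
    smax (fun l => meanRep ρ f ((Fin.cons c cs : Fin (K+1) → Fin C) l)) (f x) with hp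
  set g : X → ℝ := fun xb =>
    Real.log (1 + ∑ k, Real.exp (-⟪f xb, meanRep ρ f c - meanRep ρ f (cs k)⟫)) with hg
  have hlow : ∀ xb, g xb - (1 - inner ℝ (f xb) (meanRep ρ f c)) - M xb
      - ∑ k : Fin K, p xb k.succ * ∫ x, M x ∂(ρ (cs k)) ≤
      ∫ xs, ∫ a, ∫ a', ∫ as, infoNCE f K (A a xb) (A a' xb) (fun k => A (as k) (xs k))
      ∂(Measure.pi fun _ : Fin K => PA) ∂PA ∂PA ∂(Measure.pi fun k => ρ (cs k)) := by
    intro xb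
    let L : (Fin K → X) → ℝ := fun xs => g xb - (1 - inner ℝ (f xb) (meanRep ρ f c)) - M xb
      + ∑ k : Fin K, p xb k.succ *
        (inner ℝ (f xb) (f (xs k)) - inner ℝ (f xb) (meanRep ρ f (cs k)) - M (xs k))
    have hin : ∀ k : Fin K, Integrable (fun x => inner ℝ (f xb) (f x)) (ρ (cs k)) := fun k =>
      (integrable_enc _ f hfm hf).const_inner _
    have hinn : ∀ k : Fin K, Integrable (fun x => p xb k.succ *
        (inner ℝ (f xb) (f x) - inner ℝ (f xb) (meanRep ρ f (cs k)) - M x)) (ρ (cs k)) := fun k =>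
      (((hin k).sub (integrable_const _)).sub (hMi _)).const_mul _
    have hval : ∀ k : Fin K, ∫ x, p xb k.succ *
        (inner ℝ (f xb) (f x) - inner ℝ (f xb) (meanRep ρ f (cs k)) - M x) ∂(ρ (cs k))
        = - (p xb k.succ * ∫ x, M x ∂(ρ (cs k))) := by
      intro k
      have j1 := integrable_sub_eq (hin k) (integrable_const (inner ℝ (f xb) (meanRep ρ f (cs k))))
      have j2 := integrable_sub_eq j1.1 (hMi (cs k))
      rw [integral_const_mul, j2.2, j1.2, integral_inner (integrable_enc _ f hfm hf)]
      simp [meanRep]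
    have hev := fun k => integral_eval (fun k => ρ (cs k)) k _ (hinn k)
    have hLi : Integrable L (Measure.pi fun k => ρ (cs k)) :=
      (integrable_const _).add (integrable_finsetSum _ fun k _ => (hev k).1)
    have hLv : ∫ xs, L xs ∂(Measure.pi fun k => ρ (cs k)) =
        g xb - (1 - inner ℝ (f xb) (meanRep ρ f c)) - M xb
        - ∑ k : Fin K, p xb k.succ * ∫ x, M x ∂(ρ (cs k)) := by
      simp only [L]
      rw [integral_add (integrable_const _) (integrable_finsetSum _ fun k _ => (hev k).1),
        integral_finsetSum _ (fun k _ => (hev k).1)]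
      simp_rw [fun k => (hev k).2, hval]
      simp [sub_eq_add_neg]
    rw [← hLv]
    exact hFlow xb L hLi fun xs a a' as => infoNCE_lower ρ A f hf M hM c cs xb xs a a' as
  have hpi : ∀ j, Integrable (fun x => p x j) (ρ c) := fun j =>
    integrable_bdd _ _ ((smax_meas
      (fun l => meanRep ρ f ((Fin.cons c cs : Fin (K+1) → Fin C) l)) j).comp hfm) 1 fun x => by
      rw [abs_of_nonneg (smax_nonneg _ _ _)]; exact smax_le_one _ _ _
  have hgi : Integrable g (ρ c) := by
    refine integrable_bdd _ _ (by fun_prop) B fun x => ?_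
    have h0 : (0:ℝ) ≤ ∑ k, Real.exp (-⟪f x, meanRep ρ f c - meanRep ρ f (cs k)⟫) := by positivity
    simp only [hg, hB]
    rw [abs_of_nonneg (Real.log_nonneg (by linarith))]
    refine Real.log_le_log (by linarith) ?_
    gcongr
    have : ∀ k, Real.exp (-⟪f x, meanRep ρ f c - meanRep ρ f (cs k)⟫) ≤ Real.exp 2 := by
      intro k
      rw [Real.exp_le_exp]
      refine (neg_le_abs _).trans ((abs_real_inner_le_norm _ _).trans ?_)
      rw [hf x, one_mul]
      refine (norm_sub_le _ _).trans ?_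
      linarith [norm_meanRep_le ρ f hf c, norm_meanRep_le ρ f hf (cs k)]
    refine (Finset.sum_le_sum fun k _ => this k).trans ?_
    simp
  have hS : Integrable (fun x => ∑ k : Fin K, p x k.succ * ∫ x, M x ∂(ρ (cs k))) (ρ c) :=
    integrable_finsetSum _ fun k _ => (hpi _).mul_const _
  have hSv : ∫ x, ∑ k : Fin K, p x k.succ * ∫ x, M x ∂(ρ (cs k)) ∂(ρ c) =
      ∑ k : Fin K, (∫ x, p x k.succ ∂(ρ c)) * ∫ x, M x ∂(ρ (cs k)) := by
    rw [integral_finsetSum _ fun k _ => (hpi _).mul_const _]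
    simp_rw [integral_mul_const]
  have i1 := integrable_add_eq hF (hE c)
  have i2 := integrable_add_eq i1.1 ((hMi c).const_mul 2)
  have i3 := integrable_add_eq i2.1 (integrable_const (∫ x', M x' ∂(ρ c)))
  have i4 := integrable_add_eq i3.1 hS
  have fin := integral_mono hgi i4.1 fun x => by
    have h1 := hlow x
    have h2 := hE' c x
    show g x ≤ _
    linarith
  rw [i4.2, i3.2, i2.2, i1.2, hSv, integral_const_mul] at fin
  simp only [integral_const, probReal_univ, one_smul] at fin
  unfold supLoss
  linarith

/-- **Theorem 1 (Augmentation-aware error bound).**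
If `‖f(x)‖ = 1` for all `x`, the identity map is among the augmentations, and
`τ_K < 1`, then the supervised risk of the mean classifier satisfies
`R^sup(f) ≤ (1/(1−τ_K))·[R^un(f) − E log(Col+1) + D_min(f) + 5·D_max(f)]`. -/
theorem augmentation_aware_error_bound
    (K : ℕ) (hC : 1 ≤ C) (hK : 1 ≤ K)
    (pr : Fin C → ℝ) (hpr : ∀ c, 0 ≤ pr c) (hpr1 : ∑ c, pr c = 1)
    (ρ : Fin C → Measure X) [∀ c, IsProbabilityMeasure (ρ c)]
    (PA : Measure Ω) [IsProbabilityMeasure PA]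
    (A : Ω → X → X) (hA : Measurable fun p : Ω × X => A p.1 p.2)
    (f : X → EuclideanSpace ℝ (Fin d)) (hfm : Measurable f)
    (hf : ∀ x, ‖f x‖ = 1)
    (hid : ∃ ω : Ω, A ω = id)
    (hTau : tauK pr K < 1)
    (hDminInt1 : ∀ xb xb' : X,
      Integrable (fun a => ⨅ a' : Ω, ‖f (A a xb) - f (A a' xb')‖) PA)
    (hDminInt2 : ∀ (c : Fin C) (xb : X),
      Integrable (fun xb' => ∫ a, (⨅ a' : Ω, ‖f (A a xb) - f (A a' xb')‖) ∂PA) (ρ c))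
    (hDminInt3 : ∀ c : Fin C,
      Integrable
        (fun xb => ∫ xb', ∫ a, (⨅ a' : Ω, ‖f (A a xb) - f (A a' xb')‖) ∂PA ∂(ρ c)) (ρ c))
    (hDmaxInt : ∀ c : Fin C,
      Integrable (fun xb' => ⨆ p : Ω × Ω, ‖f (A p.1 xb') - f (A p.2 xb')‖) (ρ c)) :
    Rsup pr ρ f K ≤ (1 / (1 - tauK pr K)) *
      (Run pr ρ PA A f K - expLogCol pr K + Dmin pr ρ PA A f + 5 * Dmax pr ρ A f) := by

  obtain ⟨ω, hω⟩ := hid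
  have : Nonempty Ω := ⟨ω⟩
  set M : X → ℝ := fun x => ⨆ p : Ω × Ω, ‖f (A p.1 x) - f (A p.2 x)‖ with hMdef
  have hM : ∀ a x, ‖f (A a x) - f x‖ ≤ M x := by
    intro a x
    have hb : BddAbove (Set.range fun p : Ω × Ω => ‖f (A p.1 x) - f (A p.2 x)‖) := by
      refine ⟨2, ?_⟩
      rintro _ ⟨p, rfl⟩
      refine (norm_sub_le _ _).trans ?_
      rw [hf, hf]; norm_num
    have := le_ciSup hb (a, ω)
    simpa [hω] using this
  have hM0 : ∀ x, 0 ≤ M x := fun x => (norm_nonneg _).trans (hM ω x)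
  set E : Fin C → X → ℝ := fun c xb =>
    ∫ xb', ∫ a, (⨅ a' : Ω, ‖f (A a xb) - f (A a' xb')‖) ∂PA ∂(ρ c) with hEdef
  have hE' : ∀ c x, 1 - inner ℝ (f x) (meanRep ρ f c) ≤ E c x + M x + ∫ x', M x' ∂(ρ c) := by
    intro c x
    have hpt : ∀ x', 1 - inner ℝ (f x) (f x') ≤
        (∫ a, (⨅ a' : Ω, ‖f (A a x) - f (A a' x')‖) ∂PA) + M x + M x' := by
      intro x'
      have h1 : 1 - inner ℝ (f x) (f x') ≤ ‖f x - f x'‖ := by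
        have e := norm_sub_sq_real (f x) (f x')
        rw [hf, hf] at e
        have l : ‖f x - f x'‖ ≤ 2 := by
          refine (norm_sub_le _ _).trans ?_
          rw [hf, hf]; norm_num
        nlinarith [norm_nonneg (f x - f x')]
      have h2 : ∀ a, ‖f x - f x'‖ - M x - M x' ≤ ⨅ a' : Ω, ‖f (A a x) - f (A a' x')‖ := by
        intro a
        refine le_ciInf fun a' => ?_
        have t1 := norm_sub_le_norm_sub_add_norm_sub (f x) (f (A a x)) (f x')
        have t2 := norm_sub_le_norm_sub_add_norm_sub (f (A a x)) (f (A a' x')) (f x')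
        have t3 := hM a x
        rw [norm_sub_rev] at t3
        linarith [hM a' x']
      have h3 := integral_mono (μ := PA) (integrable_const _) (hDminInt1 x x') h2
      simp only [integral_const, probReal_univ, one_smul] at h3
      linarith
    have hi := integrable_enc (ρ c) f hfm hf
    have i0 := integrable_sub_eq (integrable_const (1:ℝ)) (hi.const_inner (f x))
    have i1 := integrable_add_eq (hDminInt2 c x) (integrable_const (M x))
    have i2 := integrable_add_eq i1.1 (hDmaxInt c)
    have h := integral_mono i0.1 i2.1 hpt
    rw [i0.2, i2.2, i1.2, integral_inner hi] at h
    simp only [integral_const, probReal_univ, one_smul] at h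
    exact h
  have hT := tuple_bound K ρ PA A hA f hfm hf M hM hDmaxInt E hDminInt3 hE'
  have hw : ∀ c (cs : Fin K → Fin C), 0 ≤ clsWeight pr c cs := fun c cs =>
    mul_nonneg (hpr c) (Finset.prod_nonneg fun k _ => hpr _)
  have hbar : Rbarsup pr ρ f K ≤ Run pr ρ PA A f K + Dmin pr ρ PA A f + 5 * Dmax pr ρ A f := by
    have hex := exch_bound K pr hpr hpr1 ρ f hfm hf (fun c => ∫ x, M x ∂(ρ c))
      (fun c => integral_nonneg hM0)
    have h := Finset.sum_le_sum fun c (_ : c ∈ Finset.univ) => Finset.sum_le_sum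
      fun cs (_ : cs ∈ Finset.univ) => mul_le_mul_of_nonneg_left (hT c cs) (hw c cs)
    simp only [mul_add, Finset.sum_add_distrib] at h
    have e1 := sum_first (K := K) pr hpr1 (fun c => ∫ x, E c x ∂(ρ c))
    have e2 := sum_first (K := K) pr hpr1 (fun c => 3 * ∫ x, M x ∂(ρ c))
    rw [e1, e2] at h
    have e3 : ∑ c, pr c * (3 * ∫ x, M x ∂(ρ c)) = 3 * ∑ c, pr c * ∫ x, M x ∂(ρ c) := by
      rw [Finset.mul_sum]; exact Finset.sum_congr rfl fun c _ => by ring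
    rw [e3] at h
    have d1 : Dmax pr ρ A f = ∑ c, pr c * ∫ x, M x ∂(ρ c) := rfl
    have d2 : Dmin pr ρ PA A f = ∑ c, pr c * ∫ x, E c x ∂(ρ c) := rfl
    rw [d1, d2]
    unfold Rbarsup Run
    linarith
  have hcol : (∑ c, ∑ cs : Fin K → Fin C,
      if colNum c cs = 0 then clsWeight pr c cs * supLoss ρ f c cs else 0) + expLogCol pr K
      ≤ Rbarsup pr ρ f K := by
    unfold expLogCol Rbarsup
    rw [← Finset.sum_add_distrib]
    refine Finset.sum_le_sum fun c _ => ?_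
    rw [← Finset.sum_add_distrib]
    refine Finset.sum_le_sum fun cs _ => ?_
    split_ifs with h0
    · simp [h0]
    · rw [zero_add]
      refine mul_le_mul_of_nonneg_left ?_ (hw c cs)
      have hlow : ∀ x, Real.log (colNum c cs + 1) ≤
          Real.log (1 + ∑ k, Real.exp (-⟪f x, meanRep ρ f c - meanRep ρ f (cs k)⟫)) := by
        intro x
        refine Real.log_le_log (by positivity) ?_
        rw [add_comm]
        gcongr
        unfold colNum
        push_cast
        refine Finset.sum_le_sum fun k _ => ?_
        split_ifs with hk
        · simp [hk]
        · positivity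
      have hgi : Integrable (fun x => Real.log
          (1 + ∑ k, Real.exp (-⟪f x, meanRep ρ f c - meanRep ρ f (cs k)⟫))) (ρ c) := by
        refine integrable_bdd _ _ (by fun_prop) (Real.log (1 + K * Real.exp 2)) fun x => ?_
        have h0 : (0:ℝ) ≤ ∑ k, Real.exp (-⟪f x, meanRep ρ f c - meanRep ρ f (cs k)⟫) := by
          positivity
        rw [abs_of_nonneg (Real.log_nonneg (by linarith))]
        refine Real.log_le_log (by linarith) ?_
        gcongr
        have : ∀ k, Real.exp (-⟪f x, meanRep ρ f c - meanRep ρ f (cs k)⟫) ≤ Real.exp 2 := by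
          intro k
          rw [Real.exp_le_exp]
          refine (neg_le_abs _).trans ((abs_real_inner_le_norm _ _).trans ?_)
          rw [hf x, one_mul]
          refine (norm_sub_le _ _).trans ?_
          linarith [norm_meanRep_le ρ f hf c, norm_meanRep_le ρ f hf (cs k)]
        refine (Finset.sum_le_sum fun k _ => this k).trans ?_
        simp
      have := integral_mono (integrable_const _) hgi hlow
      simpa [supLoss] using this
  have hpos : 0 < 1 - tauK pr K := by linarith
  unfold Rsup
  rw [div_eq_inv_mul, one_div]
  refine mul_le_mul_of_nonneg_left ?_ (inv_nonneg.2 hpos.le)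
  linarith

end
end

section
/- Let f : 𝒳 → ℝ^d be an encoder with ‖f(x)‖ = 1 for all x ∈ 𝒳 and assume the identity map belongs to 𝒜. Then the intermediate supervised risk is bounded by the unsupervised contrastive risk plus two augmentation-induced distance terms: R̄^sup(f) ≤ R^un(f) + D_min(f) + 5·D_max(f). -/
open MeasureTheory Real
open scoped BigOperators RealInnerProductSpace

noncomputable section

variable {X : Type*} [MeasurableSpace X] {Ω : Type*} [MeasurableSpace Ω] {d C : ℕ}

lemma aux_tangent {K : ℕ} (v w : Fin K → ℝ) :
    Real.log (1 + ∑ k, Real.exp (v k)) +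
      ∑ k, Real.exp (v k) / (1 + ∑ j, Real.exp (v j)) * (w k - v k)
      ≤ Real.log (1 + ∑ k, Real.exp (w k)) := by
  set Z := 1 + ∑ k, Real.exp (v k) with hZ
  have hZ0 : 0 < Z := by positivity
  set m := ∑ k, Real.exp (v k) / Z * (w k - v k) with hm
  have hW0 : 0 < 1 + ∑ k, Real.exp (w k) := by positivity
  rw [Real.le_log_iff_exp_le hW0, Real.exp_add, Real.exp_log hZ0]
  have h1 : Real.exp m * (1 - m) ≤ 1 := by
    have := Real.add_one_le_exp (-m)
    calc Real.exp m * (1 - m) ≤ Real.exp m * Real.exp (-m) := by gcongr; linarith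
      _ = 1 := by rw [← Real.exp_add]; simp
  have h2 : ∀ k, Real.exp m * (Real.exp (v k) * (1 - m) + Real.exp (v k) * (w k - v k))
      ≤ Real.exp (w k) := by
    intro k
    have := Real.add_one_le_exp (w k - v k - m)
    calc _ = Real.exp m * Real.exp (v k) * (w k - v k - m + 1) := by ring
      _ ≤ Real.exp m * Real.exp (v k) * Real.exp (w k - v k - m) := by gcongr
      _ = Real.exp (w k) := by rw [← Real.exp_add, ← Real.exp_add]; congr 1; ring
  have h3 := Finset.sum_le_sum (s := Finset.univ) (fun k _ => h2 k)
  rw [← Finset.mul_sum, Finset.sum_add_distrib, ← Finset.sum_mul] at h3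
  have h4 : ∑ k, Real.exp (v k) * (w k - v k) = Z * m := by
    rw [hm, Finset.mul_sum]
    refine Finset.sum_congr rfl fun k _ => ?_
    field_simp
  rw [h4] at h3
  have h5 : ∑ k, Real.exp (v k) = Z - 1 := by rw [hZ]; ring
  rw [h5] at h3
  nlinarith

/-- softmax weight of the k-th negative class -/
def auxP {K : ℕ} (M : Fin C → EuclideanSpace ℝ (Fin d)) (c : Fin C) (cs : Fin K → Fin C)
    (k : Fin K) (u : EuclideanSpace ℝ (Fin d)) : ℝ :=
  Real.exp ⟪u, M (cs k)⟫ / (Real.exp ⟪u, M c⟫ + ∑ j, Real.exp ⟪u, M (cs j)⟫)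

lemma auxP_eq {K : ℕ} (M : Fin C → EuclideanSpace ℝ (Fin d)) (c : Fin C) (cs : Fin K → Fin C)
    (k : Fin K) (u : EuclideanSpace ℝ (Fin d)) :
    Real.exp (-⟪u, M c - M (cs k)⟫) / (1 + ∑ j, Real.exp (-⟪u, M c - M (cs j)⟫))
      = auxP M c cs k u := by
  have h : ∀ j, Real.exp (-⟪u, M c - M (cs j)⟫) =
      Real.exp ⟪u, M (cs j)⟫ / Real.exp ⟪u, M c⟫ := by
    intro j
    rw [← Real.exp_sub, inner_sub_right]; congr 1; ring
  simp only [h, auxP, ← Finset.sum_div]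
  have : 0 < Real.exp ⟪u, M c⟫ := Real.exp_pos _
  have : 0 < Real.exp ⟪u, M c⟫ + ∑ j, Real.exp ⟪u, M (cs j)⟫ := by positivity
  field_simp

lemma auxP_nonneg {K : ℕ} (M : Fin C → EuclideanSpace ℝ (Fin d)) (c : Fin C)
    (cs : Fin K → Fin C) (k : Fin K) (u : EuclideanSpace ℝ (Fin d)) : 0 ≤ auxP M c cs k u := by
  unfold auxP; positivity

lemma auxP_sum {K : ℕ} (M : Fin C → EuclideanSpace ℝ (Fin d)) (c : Fin C)
    (cs : Fin K → Fin C) (u : EuclideanSpace ℝ (Fin d)) : ∑ k, auxP M c cs k u ≤ 1 := by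
  unfold auxP
  rw [← Finset.sum_div, div_le_one (by positivity)]
  linarith [Real.exp_pos ⟪u, M c⟫]

lemma auxP_le {K : ℕ} (M : Fin C → EuclideanSpace ℝ (Fin d)) (c : Fin C)
    (cs : Fin K → Fin C) (k : Fin K) (u : EuclideanSpace ℝ (Fin d)) : auxP M c cs k u ≤ 1 :=
  (Finset.single_le_sum (f := fun k => auxP M c cs k u) (fun k _ => auxP_nonneg M c cs k u)
    (Finset.mem_univ k)).trans (auxP_sum M c cs u)

lemma auxP_cont {K : ℕ} (M : Fin C → EuclideanSpace ℝ (Fin d)) (c : Fin C)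
    (cs : Fin K → Fin C) (k : Fin K) : Continuous (auxP M c cs k) := by
  unfold auxP
  refine Continuous.div (by fun_prop) (by fun_prop) fun u => ?_
  positivity

lemma aux_point {K : ℕ} (A : Ω → X → X) (f : X → EuclideanSpace ℝ (Fin d))
    (hf : ∀ x, ‖f x‖ = 1) (ω : Ω) (hω : A ω = id) (S : X → ℝ)
    (hS : ∀ x a a', ‖f (A a x) - f (A a' x)‖ ≤ S x)
    (M : Fin C → EuclideanSpace ℝ (Fin d)) (hM : ∀ c, ‖M c‖ ≤ 1)
    (c : Fin C) (cs : Fin K → Fin C) (x : X) (xs : Fin K → X) (a a' : Ω) (as : Fin K → Ω) :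
    Real.log (1 + ∑ k, Real.exp (-⟪f x, M c - M (cs k)⟫)) +
      ∑ k, auxP M c cs k (f x) * (⟪f x, f (xs k)⟫ - ⟪f x, M (cs k)⟫ - S (xs k))
      - S x - (1 - ⟪f x, M c⟫) ≤ infoNCE f K (A a x) (A a' x) (fun k => A (as k) (xs k)) := by
  have hS0 : 0 ≤ S x := (norm_nonneg _).trans (hS x a a)
  have hin : ∀ u v : EuclideanSpace ℝ (Fin d), ⟪u, v⟫ ≤ ‖u‖ * ‖v‖ := real_inner_le_norm
  have h1 : 0 ≤ 1 - ⟪f x, M c⟫ := by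
    have := hin (f x) (M c)
    rw [hf] at this
    linarith [hM c]
  have ht := aux_tangent (fun k => -⟪f x, M c - M (cs k)⟫)
    (fun k => -⟪f (A a x), f (A a' x) - f (A (as k) (xs k))⟫)
  simp only [auxP_eq] at ht
  unfold infoNCE
  refine le_trans ?_ ht
  have hsum : ∑ k, auxP M c cs k (f x) * (⟪f x, f (xs k)⟫ - ⟪f x, M (cs k)⟫ - S (xs k))
      - ∑ k, auxP M c cs k (f x) * (S x + (1 - ⟪f x, M c⟫))
      ≤ ∑ k, auxP M c cs k (f x) * (-⟪f (A a x), f (A a' x) - f (A (as k) (xs k))⟫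
        - -⟪f x, M c - M (cs k)⟫) := by
    rw [← Finset.sum_sub_distrib]
    refine Finset.sum_le_sum fun k _ => ?_
    rw [← mul_sub]
    refine mul_le_mul_of_nonneg_left ?_ (auxP_nonneg _ _ _ _ _)
    have e1 := hin (f (A a x)) (f (A a' x))
    have e2 := hin (f (A a x)) (f (A ω (xs k)) - f (A (as k) (xs k)))
    have e3 := hin (f (A ω x) - f (A a x)) (f (xs k))
    have s1 := hS (xs k) ω (as k)
    have s2 := hS x ω a
    simp only [hf, hω, id, inner_sub_left, inner_sub_right] at *
    linarith
  rw [← Finset.sum_mul] at hsum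
  have hP := auxP_sum M c cs (f x)
  have := mul_le_mul_of_nonneg_right hP (add_nonneg hS0 h1)
  linarith

lemma aux_chord (r Y : ℝ) (hr : 0 < r) (h1 : -r ≤ Y) (h2 : Y ≤ r) :
    Real.exp Y ≤ Real.cosh r + Y * (Real.sinh r / r) := by
  have a0 : 0 ≤ (r + Y) / (2 * r) := by apply div_nonneg <;> linarith
  have b0 : 0 ≤ (r - Y) / (2 * r) := by apply div_nonneg <;> linarith
  have ab : (r + Y) / (2 * r) + (r - Y) / (2 * r) = 1 := by field_simp; ring
  have := convexOn_exp.2 (Set.mem_univ r) (Set.mem_univ (-r)) a0 b0 ab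
  simp only [smul_eq_mul] at this
  rw [Real.cosh_eq, Real.sinh_eq]
  have e : (r + Y) / (2 * r) * r + (r - Y) / (2 * r) * -r = Y := by field_simp; ring
  rw [e] at this
  refine this.trans (le_of_eq ?_)
  field_simp; ring

lemma aux_h (r : ℝ) (hr : 0 < r) : Real.cosh r + (1 - r) * Real.sinh r ≤ 2 := by
  have e1 : Real.exp r * (2 - r) ≤ Real.exp 1 := by
    have := Real.add_one_le_exp (1 - r)
    calc Real.exp r * (2 - r) ≤ Real.exp r * Real.exp (1 - r) := by gcongr; linarith
      _ = Real.exp 1 := by rw [← Real.exp_add]; congr 1; ring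
  have e2 : r * Real.exp (-r) ≤ 1 := by
    have := Real.add_one_le_exp r
    calc r * Real.exp (-r) ≤ Real.exp r * Real.exp (-r) := by gcongr; linarith
      _ = 1 := by rw [← Real.exp_add]; simp
  have := Real.exp_one_lt_d9
  rw [Real.cosh_eq, Real.sinh_eq]
  nlinarith

lemma aux_amgm {K : ℕ} (hK : 1 ≤ K) (y : Fin K → ℝ) :
    (K : ℝ) * Real.exp ((K : ℝ)⁻¹ * ∑ j, y j) ≤ ∑ j, Real.exp (y j) := by
  have hK0 : (0 : ℝ) < K := by exact_mod_cast hK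
  set m := (K : ℝ)⁻¹ * ∑ j, y j with hm
  have h : ∀ j, Real.exp m * (y j - m + 1) ≤ Real.exp (y j) := by
    intro j
    have := Real.add_one_le_exp (y j - m)
    calc _ ≤ Real.exp m * Real.exp (y j - m) := by gcongr
      _ = _ := by rw [← Real.exp_add]; congr 1; ring
  have h3 := Finset.sum_le_sum (s := Finset.univ) (fun k _ => h k)
  rw [← Finset.mul_sum, Finset.sum_add_distrib, Finset.sum_sub_distrib] at h3
  simp only [Finset.sum_const, Finset.card_univ, Fintype.card_fin, nsmul_eq_mul, mul_one] at h3
  have : (K : ℝ) * m = ∑ j, y j := by rw [hm]; field_simp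
  rw [this] at h3
  linarith

/-- the tilt bound -/
lemma aux_tilt {K : ℕ} (hK : 1 ≤ K) (ρ : Fin C → Measure X) [∀ c, IsProbabilityMeasure (ρ c)]
    (f : X → EuclideanSpace ℝ (Fin d)) (hfm : Measurable f) (hf : ∀ x, ‖f x‖ = 1)
    (M : Fin C → EuclideanSpace ℝ (Fin d)) (hM : ∀ c, ‖M c‖ ≤ 1)
    (hMi : ∀ c v, ∫ x, ⟪f x, v⟫ ∂(ρ c) = ⟪M c, v⟫)
    (c : Fin C) (cs : Fin K → Fin C) :
    ∑ k, ∫ x, Real.exp ⟪f x, M c⟫ / (Real.exp ⟪f x, M c⟫ + ∑ j, Real.exp ⟪f x, M (cs j)⟫)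
      ∂(ρ (cs k)) ≤ 2 := by
  have hK0 : (0 : ℝ) < K := by exact_mod_cast hK
  set m : EuclideanSpace ℝ (Fin d) := (K : ℝ)⁻¹ • ∑ j, M (cs j) with hm
  set D := M c - m with hD
  have hlin : ∃ α β : ℝ, (∀ x, Real.exp ⟪f x, D⟫ ≤ α + β * ⟪f x, D⟫) ∧ α + β * ⟪m, D⟫ ≤ 2 := by
    by_cases h0 : ‖D‖ = 0
    · rw [norm_eq_zero] at h0
      refine ⟨1, 0, fun x => ?_, ?_⟩ <;> simp [h0]
    · have hr : 0 < ‖D‖ := lt_of_le_of_ne (norm_nonneg _) (Ne.symm h0)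
      refine ⟨Real.cosh ‖D‖, Real.sinh ‖D‖ / ‖D‖, fun x => ?_, ?_⟩
      · have := abs_real_inner_le_norm (f x) D
        rw [hf, one_mul, abs_le] at this
        have := aux_chord ‖D‖ _ hr this.1 this.2
        linarith
      · have h1 : ⟪m, D⟫ ≤ ‖D‖ * (1 - ‖D‖) := by
          have e : ⟪m, D⟫ = ⟪M c, D⟫ - ⟪D, D⟫ := by
            rw [← inner_sub_left]; congr 1; rw [hD]; abel
          rw [e, real_inner_self_eq_norm_sq]
          have := real_inner_le_norm (M c) D
          nlinarith [hM c]
        have h2 : 0 ≤ Real.sinh ‖D‖ := Real.sinh_nonneg_iff.2 hr.le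
        calc _ ≤ Real.cosh ‖D‖ + Real.sinh ‖D‖ / ‖D‖ * (‖D‖ * (1 - ‖D‖)) := by gcongr
          _ = Real.cosh ‖D‖ + (1 - ‖D‖) * Real.sinh ‖D‖ := by field_simp
          _ ≤ 2 := aux_h _ hr
  obtain ⟨α, β, hle, hfin⟩ := hlin
  have hpt : ∀ x, Real.exp ⟪f x, M c⟫ / (Real.exp ⟪f x, M c⟫ + ∑ j, Real.exp ⟪f x, M (cs j)⟫)
      ≤ (K : ℝ)⁻¹ * (α + β * ⟪f x, D⟫) := by
    intro x
    have h1 := aux_amgm hK (fun j => ⟪f x, M (cs j)⟫)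
    have h2 : (K : ℝ)⁻¹ * ∑ j, ⟪f x, M (cs j)⟫ = ⟪f x, m⟫ := by
      rw [hm, inner_smul_right, inner_sum]
    rw [h2] at h1
    calc _ ≤ Real.exp ⟪f x, M c⟫ / (K * Real.exp ⟪f x, m⟫) := by
          gcongr
          linarith [Real.exp_pos ⟪f x, M c⟫]
      _ = (K : ℝ)⁻¹ * Real.exp ⟪f x, D⟫ := by
          rw [hD, inner_sub_right, Real.exp_sub]; field_simp
      _ ≤ _ := by gcongr; exact hle x
  have hint : ∀ c' v, Integrable (fun x => ⟪f x, v⟫) (ρ c') := by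
    intro c' v
    refine Integrable.of_bound (by fun_prop) ‖v‖ (Filter.Eventually.of_forall fun x => ?_)
    have := norm_inner_le_norm (𝕜 := ℝ) (f x) v
    rwa [hf, one_mul] at this
  have hk : ∀ k, ∫ x, Real.exp ⟪f x, M c⟫ / (Real.exp ⟪f x, M c⟫ + ∑ j, Real.exp ⟪f x, M (cs j)⟫)
      ∂(ρ (cs k)) ≤ (K : ℝ)⁻¹ * (α + β * ⟪M (cs k), D⟫) := by
    intro k
    rw [← hMi]
    have e : (K : ℝ)⁻¹ * (α + β * ∫ x, ⟪f x, D⟫ ∂(ρ (cs k))) =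
        ∫ x, (K : ℝ)⁻¹ * (α + β * ⟪f x, D⟫) ∂(ρ (cs k)) := by
      rw [integral_const_mul, integral_add (integrable_const _) ((hint _ _).const_mul _),
        integral_const_mul]
      simp
    rw [e]
    refine integral_mono_of_nonneg (Filter.Eventually.of_forall fun x => by positivity) ?_
      (Filter.Eventually.of_forall hpt)
    exact ((integrable_const _).add ((hint _ _).const_mul _)).const_mul _
  refine (Finset.sum_le_sum fun k _ => hk k).trans (le_trans (le_of_eq ?_) hfin)
  rw [← Finset.mul_sum, Finset.sum_add_distrib, ← Finset.mul_sum, hm, inner_smul_left, sum_inner]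
  simp
  field_simp

lemma aux_int4 {Y : Type*} [MeasurableSpace Y] {ν : Measure Y} {a b c e : Y → ℝ}
    (ha : Integrable a ν) (hb : Integrable b ν) (hc : Integrable c ν) (he : Integrable e ν) :
    ∫ y, (a y + b y - c y - e y) ∂ν = ∫ y, a y ∂ν + ∫ y, b y ∂ν - ∫ y, c y ∂ν - ∫ y, e y ∂ν := by
  have h1 : Integrable (fun y => a y + b y) ν := ha.add hb
  have h2 : Integrable (fun y => a y + b y - c y) ν := h1.sub hc
  rw [integral_sub h2 he, integral_sub h1 hc, integral_add ha hb]

lemma aux_int4' {Y : Type*} [MeasurableSpace Y] {ν : Measure Y} {a b c e : Y → ℝ}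
    (ha : Integrable a ν) (hb : Integrable b ν) (hc : Integrable c ν) (he : Integrable e ν) :
    ∫ y, (a y - b y - c y - e y) ∂ν = ∫ y, a y ∂ν - ∫ y, b y ∂ν - ∫ y, c y ∂ν - ∫ y, e y ∂ν := by
  have h1 : Integrable (fun y => a y - b y) ν := ha.sub hb
  have h2 : Integrable (fun y => a y - b y - c y) ν := h1.sub hc
  rw [integral_sub h2 he, integral_sub h1 hc, integral_sub ha hb]

lemma aux_mono_step {Y : Type*} [MeasurableSpace Y] (ν : Measure Y) [IsProbabilityMeasure ν]
    (g : Y → ℝ) (hg : StronglyMeasurable g) (R : ℝ) (hR : ∀ y, ‖g y‖ ≤ R) (B : ℝ)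
    (hB : ∀ y, B ≤ g y) : B ≤ ∫ y, g y ∂ν := by
  have : ∫ _ : Y, B ∂ν ≤ ∫ y, g y ∂ν :=
    integral_mono (integrable_const _)
      (Integrable.of_bound hg.aestronglyMeasurable R (Filter.Eventually.of_forall hR)) hB
  simpa using this

lemma aux_bd_step {Y : Type*} [MeasurableSpace Y] (ν : Measure Y) [IsProbabilityMeasure ν]
    (g : Y → ℝ) (R : ℝ) (hR : ∀ y, ‖g y‖ ≤ R) : ‖∫ y, g y ∂ν‖ ≤ R := by
  have := norm_integral_le_of_norm_le_const (μ := ν) (Filter.Eventually.of_forall hR)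
  simpa using this

/-- iterated-integral lower bound -/
lemma aux_iter {X1 X2 Y1 Y2 Y3 : Type*} [MeasurableSpace X1] [MeasurableSpace X2]
    [MeasurableSpace Y1] [MeasurableSpace Y2] [MeasurableSpace Y3]
    (n1 : Measure X1) [IsProbabilityMeasure n1] (n2 : Measure X2) [IsProbabilityMeasure n2]
    (m1 : Measure Y1) [IsProbabilityMeasure m1] (m2 : Measure Y2) [IsProbabilityMeasure m2]
    (m3 : Measure Y3) [IsProbabilityMeasure m3]
    (F : X1 → X2 → Y1 → Y2 → Y3 → ℝ)
    (hF : StronglyMeasurable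
      (fun p : (((X1 × X2) × Y1) × Y2) × Y3 => F p.1.1.1.1 p.1.1.1.2 p.1.1.2 p.1.2 p.2))
    (R : ℝ) (hR : ∀ x1 x2 y1 y2 y3, ‖F x1 x2 y1 y2 y3‖ ≤ R)
    (B : X1 → X2 → ℝ) (hB : ∀ x1 x2 y1 y2 y3, B x1 x2 ≤ F x1 x2 y1 y2 y3)
    (hBi : ∀ x1, Integrable (B x1) n2) (G : X1 → ℝ) (hG : ∀ x1, ∫ x2, B x1 x2 ∂n2 = G x1)
    (hGi : Integrable G n1) :
    ∫ x1, G x1 ∂n1 ≤ ∫ x1, ∫ x2, ∫ y1, ∫ y2, ∫ y3, F x1 x2 y1 y2 y3 ∂m3 ∂m2 ∂m1 ∂n2 ∂n1 := by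
  have s3 := hF.integral_prod_right' (ν := m3)
  have s2 := s3.integral_prod_right' (ν := m2)
  have s1 := s2.integral_prod_right' (ν := m1)
  have s0 := s1.integral_prod_right' (ν := n2)
  simp only at s3 s2 s1 s0
  have b3 := fun x1 x2 y1 y2 => aux_bd_step m3 _ R (hR x1 x2 y1 y2)
  have b2 := fun x1 x2 y1 => aux_bd_step m2 _ R (b3 x1 x2 y1)
  have b1 := fun x1 x2 => aux_bd_step m1 _ R (b2 x1 x2)
  have b0 := fun x1 => aux_bd_step n2 _ R (b1 x1)
  have l3 : ∀ x1 x2 y1 y2, B x1 x2 ≤ ∫ y3, F x1 x2 y1 y2 y3 ∂m3 := fun x1 x2 y1 y2 =>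
    aux_mono_step m3 _ (hF.comp_measurable (g := fun y3 => ((((x1, x2), y1), y2), y3))
      (by fun_prop)) R (hR x1 x2 y1 y2) _ (hB x1 x2 y1 y2)
  have l2 : ∀ x1 x2 y1, B x1 x2 ≤ ∫ y2, ∫ y3, F x1 x2 y1 y2 y3 ∂m3 ∂m2 := fun x1 x2 y1 =>
    aux_mono_step m2 _ (s3.comp_measurable (g := fun y2 => (((x1, x2), y1), y2))
      (by fun_prop)) R (b3 x1 x2 y1) _ (l3 x1 x2 y1)
  have l1 : ∀ x1 x2, B x1 x2 ≤ ∫ y1, ∫ y2, ∫ y3, F x1 x2 y1 y2 y3 ∂m3 ∂m2 ∂m1 := fun x1 x2 =>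
    aux_mono_step m1 _ (s2.comp_measurable (g := fun y1 => ((x1, x2), y1))
      (by fun_prop)) R (b2 x1 x2) _ (l2 x1 x2)
  refine integral_mono hGi (Integrable.of_bound s0.aestronglyMeasurable R
    (Filter.Eventually.of_forall b0)) fun x1 => ?_
  rw [← hG x1]
  exact integral_mono (hBi x1) (Integrable.of_bound
    (s1.comp_measurable (g := fun x2 => (x1, x2)) (by fun_prop)).aestronglyMeasurable R
    (Filter.Eventually.of_forall (b1 x1))) (l1 x1)

lemma infoNCE_bd {K : ℕ} (f : X → EuclideanSpace ℝ (Fin d)) (hf : ∀ x, ‖f x‖ = 1)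
    (x x' : X) (xs : Fin K → X) :
    ‖infoNCE f K x x' xs‖ ≤ Real.log (1 + K * Real.exp 2) := by
  unfold infoNCE
  have h0 : 0 ≤ ∑ k, Real.exp (-⟪f x, f x' - f (xs k)⟫) := by positivity
  rw [Real.norm_of_nonneg (Real.log_nonneg (by linarith))]
  refine Real.log_le_log (by linarith) ?_
  have : ∑ k, Real.exp (-⟪f x, f x' - f (xs k)⟫) ≤ ∑ _k : Fin K, Real.exp 2 := by
    refine Finset.sum_le_sum fun k _ => Real.exp_le_exp.2 ?_
    have h1 := abs_real_inner_le_norm (f x) (f x' - f (xs k))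
    have h2 := norm_sub_le (f x') (f (xs k))
    simp only [hf, one_mul] at h1 h2
    rw [abs_le] at h1
    linarith
  simpa using this

lemma aux_class {K : ℕ} (ρ : Fin C → Measure X) [∀ c, IsProbabilityMeasure (ρ c)]
    (PA : Measure Ω) [IsProbabilityMeasure PA]
    (A : Ω → X → X) (hA : Measurable fun p : Ω × X => A p.1 p.2)
    (f : X → EuclideanSpace ℝ (Fin d)) (hfm : Measurable f)
    (hf : ∀ x, ‖f x‖ = 1) (ω : Ω) (hω : A ω = id) (S : X → ℝ)
    (hS : ∀ x a a', ‖f (A a x) - f (A a' x)‖ ≤ S x) (hSi : ∀ c, Integrable S (ρ c))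
    (hM : ∀ c, ‖meanRep ρ f c‖ ≤ 1)
    (hMi : ∀ c v, ∫ x, ⟪f x, v⟫ ∂(ρ c) = ⟪meanRep ρ f c, v⟫)
    (c : Fin C) (cs : Fin K → Fin C) :
    supLoss ρ f c cs -
      ∑ k, (∫ x, auxP (meanRep ρ f) c cs k (f x) ∂(ρ c)) * (∫ x, S x ∂(ρ (cs k)))
      - (∫ x, S x ∂(ρ c)) - (1 - ⟪meanRep ρ f c, meanRep ρ f c⟫) ≤
    ∫ xb, ∫ xs, ∫ a, ∫ a', ∫ as,
        infoNCE f K (A a xb) (A a' xb) (fun k => A (as k) (xs k))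
      ∂(Measure.pi fun _ : Fin K => PA) ∂PA ∂PA
      ∂(Measure.pi fun k => ρ (cs k)) ∂(ρ c) := by
  set M := meanRep ρ f with hMdef
  have hint : ∀ c' v, Integrable (fun x => ⟪f x, v⟫) (ρ c') := by
    intro c' v
    refine Integrable.of_bound (by fun_prop) ‖v‖ (Filter.Eventually.of_forall fun x => ?_)
    have := norm_inner_le_norm (𝕜 := ℝ) (f x) v
    rwa [hf, one_mul] at this
  have hPi : ∀ k, Integrable (fun x => auxP M c cs k (f x)) (ρ c) := by
    intro k
    refine Integrable.of_bound ((auxP_cont M c cs k).measurable.comp hfm).aestronglyMeasurable 1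
      (Filter.Eventually.of_forall fun x => ?_)
    rw [Real.norm_of_nonneg (auxP_nonneg _ _ _ _ _)]
    exact auxP_le _ _ _ _ _
  have hLi : Integrable
      (fun x => Real.log (1 + ∑ k, Real.exp (-⟪f x, M c - M (cs k)⟫))) (ρ c) := by
    refine Integrable.of_bound (Measurable.aestronglyMeasurable (by fun_prop))
      (Real.log (1 + K * Real.exp 2)) (Filter.Eventually.of_forall fun x => ?_)
    have h0 : 0 ≤ ∑ k, Real.exp (-⟪f x, M c - M (cs k)⟫) := by positivity
    rw [Real.norm_of_nonneg (Real.log_nonneg (by linarith))]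
    refine Real.log_le_log (by linarith) ?_
    have : ∑ k, Real.exp (-⟪f x, M c - M (cs k)⟫) ≤ ∑ _k : Fin K, Real.exp 2 := by
      refine Finset.sum_le_sum fun k _ => Real.exp_le_exp.2 ?_
      have h1 := abs_real_inner_le_norm (f x) (M c - M (cs k))
      have h2 := norm_sub_le (M c) (M (cs k))
      have h3 := hM c
      have h4 := hM (cs k)
      simp only [hf, one_mul] at h1
      rw [abs_le] at h1
      linarith
    simpa using this
  have hBk : ∀ (x : X) (k : Fin K), Integrable
      (fun y => ⟪f x, f y⟫ - ⟪f x, M (cs k)⟫ - S y) (ρ (cs k)) := by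
    intro x k
    have := hint (cs k) (f x)
    simp only [real_inner_comm] at this
    exact (this.sub (integrable_const _)).sub (hSi _)
  have hBki : ∀ (x : X) (k : Fin K),
      ∫ y, (⟪f x, f y⟫ - ⟪f x, M (cs k)⟫ - S y) ∂(ρ (cs k)) = - ∫ y, S y ∂(ρ (cs k)) := by
    intro x k
    have h1 := hint (cs k) (f x)
    have h2 := hMi (cs k) (f x)
    simp only [real_inner_comm] at h1
    simp only [real_inner_comm] at h2
    have h3 : Integrable (fun y => ⟪f x, f y⟫ - ⟪f x, M (cs k)⟫) (ρ (cs k)) :=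
      h1.sub (integrable_const _)
    rw [integral_sub h3 (hSi _), integral_sub h1 (integrable_const _), h2]
    simp
  have hBs : ∀ x, Integrable (fun xs : Fin K → X => ∑ k, auxP M c cs k (f x) *
      (⟪f x, f (xs k)⟫ - ⟪f x, M (cs k)⟫ - S (xs k))) (Measure.pi fun k => ρ (cs k)) := by
    intro x
    refine integrable_finsetSum _ fun k _ => Integrable.const_mul ?_ _
    exact integrable_comp_eval (μ := fun k => ρ (cs k)) (i := k) (hBk x k)
  have key := aux_iter (ρ c) (Measure.pi fun k => ρ (cs k)) PA PA (Measure.pi fun _ : Fin K => PA)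
    (fun xb xs a a' as => infoNCE f K (A a xb) (A a' xb) (fun k => A (as k) (xs k)))
    (by
      apply Measurable.stronglyMeasurable
      unfold infoNCE
      have m1 : Measurable (fun p : (((X × (Fin K → X)) × Ω) × Ω) × (Fin K → Ω) =>
          f (A p.1.1.2 p.1.1.1.1)) :=
        hfm.comp (hA.comp (g := fun q : Ω × X => A q.1 q.2)
          (f := fun p : (((X × (Fin K → X)) × Ω) × Ω) × (Fin K → Ω) => (p.1.1.2, p.1.1.1.1))
          (by fun_prop))
      have m2 : Measurable (fun p : (((X × (Fin K → X)) × Ω) × Ω) × (Fin K → Ω) =>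
          f (A p.1.2 p.1.1.1.1)) :=
        hfm.comp (hA.comp (g := fun q : Ω × X => A q.1 q.2)
          (f := fun p : (((X × (Fin K → X)) × Ω) × Ω) × (Fin K → Ω) => (p.1.2, p.1.1.1.1))
          (by fun_prop))
      have m3 : ∀ k, Measurable (fun p : (((X × (Fin K → X)) × Ω) × Ω) × (Fin K → Ω) =>
          f (A (p.2 k) (p.1.1.1.2 k))) := fun k =>
        hfm.comp (hA.comp (g := fun q : Ω × X => A q.1 q.2)
          (f := fun p : (((X × (Fin K → X)) × Ω) × Ω) × (Fin K → Ω) => (p.2 k, p.1.1.1.2 k))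
          (by fun_prop))
      fun_prop)
    (Real.log (1 + K * Real.exp 2)) (fun _ _ _ _ _ => infoNCE_bd f hf _ _ _)
    (fun x xs => Real.log (1 + ∑ k, Real.exp (-⟪f x, M c - M (cs k)⟫)) +
      ∑ k, auxP M c cs k (f x) * (⟪f x, f (xs k)⟫ - ⟪f x, M (cs k)⟫ - S (xs k))
      - S x - (1 - ⟪f x, M c⟫))
    (fun x xs a a' as => aux_point A f hf ω hω S hS M hM c cs x xs a a' as)
    (fun x => (((integrable_const _).add (hBs x)).sub (integrable_const _)).sub
      (integrable_const _))
    (fun x => Real.log (1 + ∑ k, Real.exp (-⟪f x, M c - M (cs k)⟫)) +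
      ∑ k, auxP M c cs k (f x) * (- ∫ y, S y ∂(ρ (cs k))) - S x - (1 - ⟪f x, M c⟫))
    (by
      intro x
      rw [aux_int4 (integrable_const _) (hBs x) (integrable_const _) (integrable_const _),
        integral_finsetSum]
      · simp only [integral_const_mul]
        have : ∀ k, ∫ xs : Fin K → X, (⟪f x, f (xs k)⟫ - ⟪f x, M (cs k)⟫ - S (xs k))
            ∂(Measure.pi fun k => ρ (cs k)) = - ∫ y, S y ∂(ρ (cs k)) := by
          intro k
          rw [← hBki x k]
          exact integral_comp_eval (μ := fun k => ρ (cs k)) (i := k)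
            (f := fun y => ⟪f x, f y⟫ - ⟪f x, M (cs k)⟫ - S y) (hBk x k).aestronglyMeasurable
        simp only [this]
        simp
      · intro k _
        exact (integrable_comp_eval (μ := fun k => ρ (cs k)) (i := k) (hBk x k)).const_mul _)
    (((hLi.add (integrable_finsetSum _ fun k _ => (hPi k).mul_const _)).sub (hSi c)).sub
      ((integrable_const _).sub (hint _ _)))
  refine le_trans (le_of_eq ?_) key
  have hsumi : Integrable (fun x => ∑ k, auxP M c cs k (f x) * (- ∫ y, S y ∂(ρ (cs k)))) (ρ c) :=
    integrable_finsetSum _ fun k _ => (hPi k).mul_const _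
  have hei : Integrable (fun x => 1 - ⟪f x, M c⟫) (ρ c) := (integrable_const _).sub (hint _ _)
  rw [aux_int4 hLi hsumi (hSi c) hei,
    integral_sub (integrable_const _) (hint _ _), hMi,
    integral_finsetSum _ fun k _ => (hPi k).mul_const _]
  simp only [mul_neg, integral_neg, integral_mul_const, Finset.sum_neg_distrib]
  simp only [supLoss, ← hMdef, integral_const, probReal_univ, one_smul]
  ring

lemma aux_swap {K : ℕ} (pr : Fin C → ℝ) (k : Fin K)
    (H : Fin C → (Fin K → Fin C) → ℝ) :
    ∑ c, ∑ cs : Fin K → Fin C, clsWeight pr c cs * H c cs =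
    ∑ c, ∑ cs : Fin K → Fin C, clsWeight pr c cs * H (cs k) (Function.update cs k c) := by
  rw [← Fintype.sum_prod_type', ← Fintype.sum_prod_type']
  let e : Fin C × (Fin K → Fin C) → Fin C × (Fin K → Fin C) :=
    fun p => (p.2 k, Function.update p.2 k p.1)
  have he : Function.Involutive e := by
    rintro ⟨c, cs⟩
    simp [e]
  refine (Fintype.sum_equiv he.toPerm _ _ fun p => ?_).symm
  obtain ⟨c, cs⟩ := p
  change _ = clsWeight pr (cs k) (Function.update cs k c) * H (cs k) (Function.update cs k c)
  congr 1
  unfold clsWeight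
  have h1 : ∀ j, pr (Function.update cs k c j) =
      Function.update (fun j => pr (cs j)) k (pr c) j := by
    intro j
    by_cases h : j = k
    · subst h; simp
    · simp [h]
  simp only [h1]
  rw [Finset.prod_update_of_mem (Finset.mem_univ k),
    ← Finset.mul_prod_erase Finset.univ (fun j => pr (cs j)) (Finset.mem_univ k),
    Finset.sdiff_singleton_eq_erase]
  ring

lemma auxP_swap {K : ℕ} (M : Fin C → EuclideanSpace ℝ (Fin d)) (c : Fin C)
    (cs : Fin K → Fin C) (k : Fin K) (u : EuclideanSpace ℝ (Fin d)) :
    auxP M (cs k) (Function.update cs k c) k u =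
      Real.exp ⟪u, M c⟫ / (Real.exp ⟪u, M c⟫ + ∑ j, Real.exp ⟪u, M (cs j)⟫) := by
  unfold auxP
  have h1 : ∀ j, Real.exp ⟪u, M (Function.update cs k c j)⟫ =
      Function.update (fun j => Real.exp ⟪u, M (cs j)⟫) k (Real.exp ⟪u, M c⟫) j := by
    intro j
    by_cases h : j = k
    · subst h; simp
    · simp [h]
  simp only [h1]
  rw [Finset.sum_update_of_mem (Finset.mem_univ k),
    ← Finset.add_sum_erase Finset.univ (fun j => Real.exp ⟪u, M (cs j)⟫) (Finset.mem_univ k),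
    Finset.sdiff_singleton_eq_erase, Function.update_self]
  congr 1
  ring

lemma aux_wsum {K : ℕ} (pr : Fin C → ℝ) (hpr1 : ∑ c, pr c = 1) (T : Fin C → ℝ) :
    ∑ c, ∑ cs : Fin K → Fin C, clsWeight pr c cs * T c = ∑ c, pr c * T c := by
  refine Finset.sum_congr rfl fun c _ => ?_
  rw [← Finset.sum_mul]
  congr 1
  unfold clsWeight
  rw [← Finset.mul_sum]
  have : ∑ cs : Fin K → Fin C, ∏ k, pr (cs k) = 1 := by
    have := (Finset.prod_univ_sum (fun _ : Fin K => (Finset.univ : Finset (Fin C)))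
      (fun _ j => pr j)).symm
    rw [Fintype.piFinset_univ] at this
    rw [this]
    simp [hpr1]
  rw [this, mul_one]

lemma aux_dmin (ρ : Fin C → Measure X) [∀ c, IsProbabilityMeasure (ρ c)]
    (PA : Measure Ω) [IsProbabilityMeasure PA] (A : Ω → X → X)
    (f : X → EuclideanSpace ℝ (Fin d)) (hfm : Measurable f)
    (hf : ∀ x, ‖f x‖ = 1) (ω : Ω) (hω : A ω = id) (S : X → ℝ)
    (hS : ∀ x a a', ‖f (A a x) - f (A a' x)‖ ≤ S x) (hSi : ∀ c, Integrable S (ρ c))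
    (hMi : ∀ c v, ∫ x, ⟪f x, v⟫ ∂(ρ c) = ⟪meanRep ρ f c, v⟫)
    (hDminInt1 : ∀ xb xb' : X,
      Integrable (fun a => ⨅ a' : Ω, ‖f (A a xb) - f (A a' xb')‖) PA)
    (hDminInt2 : ∀ (c : Fin C) (xb : X),
      Integrable (fun xb' => ∫ a, (⨅ a' : Ω, ‖f (A a xb) - f (A a' xb')‖) ∂PA) (ρ c))
    (hDminInt3 : ∀ c : Fin C,
      Integrable
        (fun xb => ∫ xb', ∫ a, (⨅ a' : Ω, ‖f (A a xb) - f (A a' xb')‖) ∂PA ∂(ρ c)) (ρ c))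
    (c : Fin C) :
    1 - ⟪meanRep ρ f c, meanRep ρ f c⟫ ≤
      (∫ xb, ∫ xb', ∫ a, (⨅ a' : Ω, ‖f (A a xb) - f (A a' xb')‖) ∂PA ∂(ρ c) ∂(ρ c))
        + 2 * ∫ x, S x ∂(ρ c) := by
  haveI : Nonempty Ω := ⟨ω⟩
  have hint : ∀ c' v, Integrable (fun x => ⟪f x, v⟫) (ρ c') := by
    intro c' v
    refine Integrable.of_bound (by fun_prop) ‖v‖ (Filter.Eventually.of_forall fun x => ?_)
    have := norm_inner_le_norm (𝕜 := ℝ) (f x) v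
    rwa [hf, one_mul] at this
  have h0 : ∀ x y a, 1 - ⟪f x, f y⟫ - S x - S y ≤ ⨅ a' : Ω, ‖f (A a x) - f (A a' y)‖ := by
    intro x y a
    refine le_ciInf fun a' => ?_
    have e1 := norm_sub_sq_real (f x) (f y)
    have e2 : ‖f x - f y‖ ≤ 2 := by
      have := norm_sub_le (f x) (f y)
      simp only [hf] at this; linarith
    have s1 := hS x ω a
    have s2 := hS y a' ω
    simp only [hω, id] at s1 s2
    have e3 : ‖f x - f y‖ ≤ ‖f x - f (A a x)‖ + ‖f (A a x) - f (A a' y)‖ + ‖f (A a' y) - f y‖ := by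
      have : f x - f y = (f x - f (A a x)) + (f (A a x) - f (A a' y)) + (f (A a' y) - f y) := by
        abel
      rw [this]
      exact norm_add₃_le
    simp only [hf] at e1
    nlinarith [norm_nonneg (f x - f y)]
  have h1 : ∀ x y, 1 - ⟪f x, f y⟫ - S x - S y ≤ ∫ a, (⨅ a' : Ω, ‖f (A a x) - f (A a' y)‖) ∂PA := by
    intro x y
    have := integral_mono (integrable_const _) (hDminInt1 x y) (h0 x y)
    simpa using this
  have h2 : ∀ x, 1 - ⟪f x, meanRep ρ f c⟫ - S x - ∫ y, S y ∂(ρ c) ≤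
      ∫ y, ∫ a, (⨅ a' : Ω, ‖f (A a x) - f (A a' y)‖) ∂PA ∂(ρ c) := by
    intro x
    have i1 : Integrable (fun y => ⟪f x, f y⟫) (ρ c) := by
      have := hint c (f x)
      simpa only [real_inner_comm] using this
    have i2 : ∫ y, ⟪f x, f y⟫ ∂(ρ c) = ⟪f x, meanRep ρ f c⟫ := by
      have := hMi c (f x)
      rw [real_inner_comm] at this
      rw [← this]
      exact integral_congr_ae (Filter.Eventually.of_forall fun y => real_inner_comm _ _)
    have := integral_mono ((((integrable_const _).sub i1).sub (integrable_const _)).sub (hSi c))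
      (hDminInt2 c x) (h1 x)
    simp only [Pi.sub_apply] at this
    rw [aux_int4' (integrable_const _) i1 (integrable_const _) (hSi c), i2] at this
    simpa using this
  have i1 := hint c (meanRep ρ f c)
  have := integral_mono ((((integrable_const _).sub i1).sub (hSi c)).sub (integrable_const _))
      (hDminInt3 c) h2
  simp only [Pi.sub_apply] at this
  rw [aux_int4' (integrable_const _) i1 (hSi c) (integrable_const _), hMi] at this
  simp only [integral_const, probReal_univ, one_smul] at this
  linarith

/-- **Theorem 6 (Error bound of `R̄^sup`).**
For `‖f(·)‖ = 1` and identity among the augmentations, the intermediate supervised risk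
is bounded by the unsupervised risk plus the two augmentation-induced distance terms:
`R̄^sup(f) ≤ R^un(f) + D_min(f) + 5·D_max(f)`. -/
theorem intermediate_supervised_risk_bound
    (K : ℕ) (hC : 1 ≤ C) (hK : 1 ≤ K)
    (pr : Fin C → ℝ) (hpr : ∀ c, 0 ≤ pr c) (hpr1 : ∑ c, pr c = 1)
    (ρ : Fin C → Measure X) [∀ c, IsProbabilityMeasure (ρ c)]
    (PA : Measure Ω) [IsProbabilityMeasure PA]
    (A : Ω → X → X) (hA : Measurable fun p : Ω × X => A p.1 p.2)
    (f : X → EuclideanSpace ℝ (Fin d)) (hfm : Measurable f)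
    (hf : ∀ x, ‖f x‖ = 1)
    (hid : ∃ ω : Ω, A ω = id)
    (hDminInt1 : ∀ xb xb' : X,
      Integrable (fun a => ⨅ a' : Ω, ‖f (A a xb) - f (A a' xb')‖) PA)
    (hDminInt2 : ∀ (c : Fin C) (xb : X),
      Integrable (fun xb' => ∫ a, (⨅ a' : Ω, ‖f (A a xb) - f (A a' xb')‖) ∂PA) (ρ c))
    (hDminInt3 : ∀ c : Fin C,
      Integrable
        (fun xb => ∫ xb', ∫ a, (⨅ a' : Ω, ‖f (A a xb) - f (A a' xb')‖) ∂PA ∂(ρ c)) (ρ c))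
    (hDmaxInt : ∀ c : Fin C,
      Integrable (fun xb' => ⨆ p : Ω × Ω, ‖f (A p.1 xb') - f (A p.2 xb')‖) (ρ c)) :
    Rbarsup pr ρ f K ≤
      Run pr ρ PA A f K + Dmin pr ρ PA A f + 5 * Dmax pr ρ A f := by
  obtain ⟨ω, hω⟩ := hid
  set S : X → ℝ := fun x => ⨆ p : Ω × Ω, ‖f (A p.1 x) - f (A p.2 x)‖ with hSdef
  have hS : ∀ x a a', ‖f (A a x) - f (A a' x)‖ ≤ S x := by
    intro x a a'
    refine le_ciSup (f := fun p : Ω × Ω => ‖f (A p.1 x) - f (A p.2 x)‖) ⟨2, ?_⟩ (a, a')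
    rintro _ ⟨p, rfl⟩
    have := norm_sub_le (f (A p.1 x)) (f (A p.2 x))
    simp only [hf] at this
    simp only
    linarith
  have hS0 : ∀ x, 0 ≤ S x := fun x => (norm_nonneg _).trans (hS x ω ω)
  have hfi : ∀ c, Integrable f (ρ c) := fun c =>
    Integrable.of_bound hfm.aestronglyMeasurable 1
      (Filter.Eventually.of_forall fun x => (hf x).le)
  have hMi : ∀ c v, ∫ x, ⟪f x, v⟫ ∂(ρ c) = ⟪meanRep ρ f c, v⟫ := by
    intro c v
    rw [meanRep, real_inner_comm, ← integral_inner (hfi c)]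
    exact integral_congr_ae (Filter.Eventually.of_forall fun y => real_inner_comm _ _)
  have hM : ∀ c, ‖meanRep ρ f c‖ ≤ 1 := by
    intro c
    have := norm_integral_le_of_norm_le_const (μ := ρ c) (f := f)
      (Filter.Eventually.of_forall fun x => (hf x).le)
    simpa [meanRep] using this
  have hw : ∀ (c : Fin C) (cs : Fin K → Fin C), 0 ≤ clsWeight pr c cs := fun c cs =>
    mul_nonneg (hpr c) (Finset.prod_nonneg fun k _ => hpr _)
  set σ : Fin C → ℝ := fun c => ∫ x, S x ∂(ρ c) with hσ
  have hσ0 : ∀ c, 0 ≤ σ c := fun c => integral_nonneg hS0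
  set δ : Fin C → ℝ := fun c =>
    ∫ xb, ∫ xb', ∫ a, (⨅ a' : Ω, ‖f (A a xb) - f (A a' xb')‖) ∂PA ∂(ρ c) ∂(ρ c) with hδ
  set Q : Fin K → Fin C → (Fin K → Fin C) → ℝ := fun k c cs =>
    (∫ x, auxP (meanRep ρ f) c cs k (f x) ∂(ρ c)) * σ (cs k) with hQ
  have hQb : ∑ c, ∑ cs : Fin K → Fin C, clsWeight pr c cs * ∑ k, Q k c cs
      ≤ 2 * ∑ c, pr c * σ c := by
    have e1 : ∑ c, ∑ cs : Fin K → Fin C, clsWeight pr c cs * ∑ k, Q k c cs =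
        ∑ k, ∑ c, ∑ cs : Fin K → Fin C, clsWeight pr c cs * Q k c cs := by
      simp only [Finset.mul_sum]
      rw [Finset.sum_comm]
      rw [Finset.sum_comm' (t' := Finset.univ) (s' := fun _ => Finset.univ) (by simp)]
      rw [Finset.sum_comm (s := (Finset.univ : Finset (Fin K)))]
      refine Finset.sum_congr rfl fun c _ => ?_
      rw [Finset.sum_comm]
    have e2 : ∑ k, ∑ c, ∑ cs : Fin K → Fin C, clsWeight pr c cs * Q k c cs =
        ∑ c, ∑ cs : Fin K → Fin C, clsWeight pr c cs *
          ∑ k, Q k (cs k) (Function.update cs k c) := by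
      simp only [Finset.mul_sum]
      rw [Finset.sum_congr rfl fun k _ => aux_swap pr k (Q k)]
      rw [Finset.sum_comm]
      refine Finset.sum_congr rfl fun c _ => ?_
      rw [Finset.sum_comm]
    rw [e1, e2, ← aux_wsum (K := K) pr hpr1 σ, Finset.mul_sum]
    refine Finset.sum_le_sum fun c _ => ?_
    rw [Finset.mul_sum]
    refine Finset.sum_le_sum fun cs _ => ?_
    have ht := aux_tilt hK ρ f hfm hf (meanRep ρ f) hM hMi c cs
    have e3 : ∑ k, Q k (cs k) (Function.update cs k c) =
        (∑ k, ∫ x, Real.exp ⟪f x, meanRep ρ f c⟫ / (Real.exp ⟪f x, meanRep ρ f c⟫ +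
          ∑ j, Real.exp ⟪f x, meanRep ρ f (cs j)⟫) ∂(ρ (cs k))) * σ c := by
      rw [Finset.sum_mul]
      refine Finset.sum_congr rfl fun k _ => ?_
      simp only [hQ, auxP_swap, Function.update_self]
    rw [e3]
    have := mul_le_mul_of_nonneg_left (mul_le_mul_of_nonneg_right ht (hσ0 c)) (hw c cs)
    linarith
  have hmain : ∀ (c : Fin C) (cs : Fin K → Fin C),
      clsWeight pr c cs * supLoss ρ f c cs ≤ clsWeight pr c cs *
        (∫ xb, ∫ xs, ∫ a, ∫ a', ∫ as,
          infoNCE f K (A a xb) (A a' xb) (fun k => A (as k) (xs k))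
          ∂(Measure.pi fun _ : Fin K => PA) ∂PA ∂PA
          ∂(Measure.pi fun k => ρ (cs k)) ∂(ρ c)) + clsWeight pr c cs * ∑ k, Q k c cs
        + clsWeight pr c cs * (δ c + 3 * σ c) := by
    intro c cs
    rw [← mul_add, ← mul_add]
    refine mul_le_mul_of_nonneg_left ?_ (hw c cs)
    have h1 := aux_class ρ PA A hA f hfm hf ω hω S hS hDmaxInt hM hMi c cs
    have h2 := aux_dmin ρ PA A f hfm hf ω hω S hS hDmaxInt hMi hDminInt1 hDminInt2 hDminInt3 c
    simp only [hQ, hδ, hσ]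
    linarith
  have hfin := Finset.sum_le_sum (s := (Finset.univ : Finset (Fin C)))
    fun c _ => Finset.sum_le_sum (s := (Finset.univ : Finset (Fin K → Fin C)))
      fun cs _ => hmain c cs
  simp only [Finset.sum_add_distrib] at hfin
  rw [aux_wsum (K := K) pr hpr1 (fun c => δ c + 3 * σ c)] at hfin
  have hsplit : ∑ c, pr c * (δ c + 3 * σ c) = ∑ c, pr c * δ c + 3 * ∑ c, pr c * σ c := by
    rw [Finset.mul_sum, ← Finset.sum_add_distrib]
    exact Finset.sum_congr rfl fun c _ => by ring
  rw [hsplit] at hfin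
  have d1 : Dmin pr ρ PA A f = ∑ c, pr c * δ c := rfl
  have d2 : Dmax pr ρ A f = ∑ c, pr c * σ c := rfl
  rw [d1, d2]
  unfold Rbarsup Run
  linarith

end
end
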